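/- arXiv:1907.02623 — 2 statements merged into one kernel-verified Lean document; each statement's English description precedes it below -/
import Mathlib

section
/- Let q be a prime power of the form q = 12c² + 4c + 3 for some integer c, and let n = q². Then in the abelian group G = ℤ/2ℤ × F, where F is a finite field with q² elements, there exist subsets B₀, B₁, B₂, B₃ with |B₀| = |B₂| = |B₃| = q² and |B₁| = q² − 1 such that for every nonzero g ∈ G, N(B₀,B₀;g) + N(B₁,B₁;g) + N(B₂,B₂;g) + N(B₃,B₃;g) = 2q² − 2; that is, {B₀,B₁,B₂,B₃} is a difference family with parameters (2n; n, n, n, n−1; 2n−2) in ℤ/2ℤ × F. -/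
/-- The number of pairs `(u, v) ∈ A × B` with `u - v = g`. -/
noncomputable def diffCount {G : Type*} [AddGroup G] (A B : Set G) (g : G) : ℕ :=
  Set.ncard {p : G × G | p.1 ∈ A ∧ p.2 ∈ B ∧ p.1 - p.2 = g}


open Finset

/-- The autocorrelation of an integer-valued function on a finite abelian group. -/
def autocorr {A : Type*} [AddGroup A] [Fintype A] (u : A → ℤ) (g : A) : ℤ :=
  ∑ x, u (x + g) * u x

lemma diffCount_self_eq_sum {A : Type*} [AddGroup A] [Fintype A] (B : Set A) (ind : A → ℤ)
    (h1 : ∀ x ∈ B, ind x = 1) (h0 : ∀ x ∉ B, ind x = 0) (g : A) :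
    (diffCount B B g : ℤ) = ∑ x, ind (g + x) * ind x := by
  classical
  have hset : {p : A × A | p.1 ∈ B ∧ p.2 ∈ B ∧ p.1 - p.2 = g}
      = (fun x : A => (g + x, x)) '' {x | g + x ∈ B ∧ x ∈ B} := by
    ext ⟨x, y⟩
    simp only [Set.mem_ofPred_eq, Set.mem_image, Prod.mk.injEq]
    constructor
    · rintro ⟨hx, hy, rfl⟩
      exact ⟨y, by simpa using ⟨hx, hy⟩, by simp, rfl⟩
    · rintro ⟨z, ⟨hz, hz'⟩, rfl, rfl⟩
      exact ⟨hz, hz', by simp⟩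
  have hind : ∀ x, ind (g + x) * ind x = if g + x ∈ B ∧ x ∈ B then 1 else 0 := by
    intro x
    by_cases hx : x ∈ B <;> by_cases hy : g + x ∈ B <;> simp [hx, hy, h0, h1]
  rw [diffCount, hset, Set.ncard_image_of_injective _ (fun x y h => (Prod.mk.inj h).2),
    Set.ncard_eq_toFinset_card']
  simp [hind, Finset.sum_boole]

/-- The sign `1` at `0` and `-1` at `1`. -/
def zmodTwoSign (e : ZMod 2) : ℤ := if e = 0 then 1 else -1

lemma zmodTwoSign_add (e f : ZMod 2) :
    zmodTwoSign (e + f) = zmodTwoSign e * zmodTwoSign f := by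
  revert e f; decide

lemma sum_zmodTwo_prod {F : Type*} [Fintype F] (f : ZMod 2 × F → ℤ) :
    ∑ p, f p = ∑ x, (f (0, x) + f (1, x)) := by
  rw [Fintype.sum_prod_type_right]
  exact Finset.sum_congr rfl fun x _ => Fin.sum_univ_two _

/-- The subset of `ℤ/2 × F` whose indicator function is `(1 + u ± v) / 2`. -/
def twistedSet {F : Type*} (u v : F → ℤ) : Set (ZMod 2 × F) :=
  {p | u p.2 + zmodTwoSign p.1 * v p.2 = 1}

section twistedSet

variable {F : Type*} [AddCommGroup F] [Fintype F] (u v : F → ℤ)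

omit [AddCommGroup F] [Fintype F] in
lemma twistedSet_indicator
    (huv : ∀ x, (u x = 0 ∧ (v x = 1 ∨ v x = -1)) ∨ (v x = 0 ∧ (u x = 1 ∨ u x = -1)))
    (p : ZMod 2 × F) [Decidable (p ∈ twistedSet u v)] :
    2 * (if p ∈ twistedSet u v then 1 else 0) = 1 + u p.2 + zmodTwoSign p.1 * v p.2 := by
  have hs : zmodTwoSign p.1 = 1 ∨ zmodTwoSign p.1 = -1 := by
    generalize p.1 = e; revert e; decide
  simp only [twistedSet, Set.mem_ofPred_eq]
  rcases huv p.2 with ⟨h1, h2 | h2⟩ | ⟨h1, h2 | h2⟩ <;> rcases hs with hs | hs <;>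
    simp [h1, h2, hs]

omit [AddCommGroup F] in
lemma ncard_twistedSet
    (huv : ∀ x, (u x = 0 ∧ (v x = 1 ∨ v x = -1)) ∨ (v x = 0 ∧ (u x = 1 ∨ u x = -1))) :
    ((twistedSet u v).ncard : ℤ) = Fintype.card F + ∑ x, u x := by
  classical
  have h : 2 * ((twistedSet u v).ncard : ℤ) = 2 * (Fintype.card F + ∑ x, u x) := by
    rw [Set.ncard_eq_toFinset_card']
    have : ((twistedSet u v).toFinset.card : ℤ)
        = ∑ p : ZMod 2 × F, if p ∈ twistedSet u v then 1 else 0 := by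
      simp [Finset.sum_boole, Set.toFinset]
    rw [this, Finset.mul_sum, Finset.sum_congr rfl fun p _ => twistedSet_indicator u v huv p,
      sum_zmodTwo_prod]
    simp only [zmodTwoSign]
    simp [Finset.sum_add_distrib]
    ring
  linarith

lemma diffCount_twistedSet
    (huv : ∀ x, (u x = 0 ∧ (v x = 1 ∨ v x = -1)) ∨ (v x = 0 ∧ (u x = 1 ∨ u x = -1)))
    (e : ZMod 2) (g : F) :
    2 * (diffCount (twistedSet u v) (twistedSet u v) (e, g) : ℤ)
      = Fintype.card F + 2 * ∑ x, u x + autocorr u g + zmodTwoSign e * autocorr v g := by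
  classical
  have h : 4 * (diffCount (twistedSet u v) (twistedSet u v) (e, g) : ℤ)
      = 2 * (Fintype.card F + 2 * ∑ x, u x + autocorr u g
          + zmodTwoSign e * autocorr v g) := by
    rw [diffCount_self_eq_sum _ (fun p => if p ∈ twistedSet u v then 1 else 0)
      (fun x hx => by simp [hx]) (fun x hx => by simp [hx]), Finset.mul_sum]
    have hterm : ∀ p : ZMod 2 × F,
        (4 * ((if (e, g) + p ∈ twistedSet u v then 1 else 0)
          * (if p ∈ twistedSet u v then 1 else 0)) : ℤ)
        = (1 + u (p.2 + g) + zmodTwoSign e * zmodTwoSign p.1 * v (p.2 + g))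
          * (1 + u p.2 + zmodTwoSign p.1 * v p.2) := by
      intro p
      have h1 := twistedSet_indicator u v huv p
      have h2 := twistedSet_indicator u v huv ((e, g) + p)
      rw [← h1, show p.2 + g = ((e, g) + p).2 from add_comm _ _, ← zmodTwoSign_add,
        show e + p.1 = ((e, g) + p).1 from rfl, ← h2]
      ring
    rw [Finset.sum_congr rfl fun p _ => hterm p, sum_zmodTwo_prod]
    have hshift : ∑ x, u (x + g) = ∑ x, u x :=
      Fintype.sum_equiv (Equiv.addRight g) _ _ fun _ => rfl
    calc _ = ∑ x, (2 + 2 * u (x + g) + 2 * u x + 2 * (u (x + g) * u x)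
          + 2 * zmodTwoSign e * (v (x + g) * v x)) := by
          refine Finset.sum_congr rfl fun x _ => ?_
          simp only [show zmodTwoSign 0 = 1 from rfl, show zmodTwoSign 1 = -1 from rfl]
          ring
      _ = _ := by
          simp only [Finset.sum_add_distrib, ← Finset.mul_sum, hshift, autocorr]
          simp
          ring
  linarith

end twistedSet

/-- Four pairs of ternary functions with complementary supports whose total autocorrelations
are those of a difference family with parameters `(2n; n, n-1, n, n; 2n-2)`. -/
lemma exists_differenceFamily_of_autocorr {F : Type*} [AddCommGroup F] [Fintype F]
    [DecidableEq F]
    (u v : Fin 4 → F → ℤ)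
    (huv : ∀ i x, (u i x = 0 ∧ (v i x = 1 ∨ v i x = -1)) ∨
      (v i x = 0 ∧ (u i x = 1 ∨ u i x = -1)))
    (hsum : ∀ i, ∑ x, u i x = if i = 1 then -1 else 0)
    (hu : ∀ g, ∑ i, autocorr (u i) g = (if g = 0 then 2 * (Fintype.card F : ℤ) + 1 else 0) - 2)
    (hv : ∀ g, ∑ i, autocorr (v i) g = if g = 0 then 2 * (Fintype.card F : ℤ) + 1 else 0) :
    ∃ B₀ B₁ B₂ B₃ : Set (ZMod 2 × F),
      B₀.ncard = Fintype.card F ∧ B₁.ncard = Fintype.card F - 1 ∧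
      B₂.ncard = Fintype.card F ∧ B₃.ncard = Fintype.card F ∧
      ∀ g : ZMod 2 × F, g ≠ 0 →
        diffCount B₀ B₀ g + diffCount B₁ B₁ g + diffCount B₂ B₂ g + diffCount B₃ B₃ g
          = 2 * Fintype.card F - 2 := by
  have hcard : 0 < Fintype.card F := Fintype.card_pos
  have hn := fun i => ncard_twistedSet (u i) (v i) (huv i)
  have hd := fun i => diffCount_twistedSet (u i) (v i) (huv i)
  simp only [hsum] at hn hd
  refine ⟨twistedSet (u 0) (v 0), twistedSet (u 1) (v 1), twistedSet (u 2) (v 2),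
    twistedSet (u 3) (v 3), ?_, ?_, ?_, ?_, ?_⟩
  · have := hn 0; simp at this; exact_mod_cast this
  · have := hn 1; simp at this; omega
  · have := hn 2; simp at this; exact_mod_cast this
  · have := hn 3; simp at this; exact_mod_cast this
  · rintro ⟨e, g⟩ hg
    have h0 := hd 0 e g
    have h1 := hd 1 e g
    have h2 := hd 2 e g
    have h3 := hd 3 e g
    have hu' := hu g
    have hv' := hv g
    simp only [Fin.sum_univ_four] at hu' hv'
    simp at h0 h1 h2 h3
    have hv'' : zmodTwoSign e * (autocorr (v 0) g + autocorr (v 1) g + autocorr (v 2) g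
      + autocorr (v 3) g) = - (if g = 0 then 2 * (Fintype.card F : ℤ) + 1 else 0) := by
      rw [hv']
      by_cases hg0 : g = 0
      · have he : e ≠ 0 := by rintro rfl; exact hg (by simp [hg0])
        simp [hg0, zmodTwoSign, he]
      · simp [hg0]
    have hv3 := mul_add (zmodTwoSign e) (autocorr (v 0) g + autocorr (v 1) g
      + autocorr (v 2) g) (autocorr (v 3) g)
    have hv4 : zmodTwoSign e * autocorr (v 0) g + zmodTwoSign e * autocorr (v 1) g
      + zmodTwoSign e * autocorr (v 2) g + zmodTwoSign e * autocorr (v 3) g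
      = - (if g = 0 then 2 * (Fintype.card F : ℤ) + 1 else 0) := by
      rw [← hv'']; ring
    have key : 2 * ((diffCount (twistedSet (u 0) (v 0)) (twistedSet (u 0) (v 0)) (e, g) : ℤ)
      + diffCount (twistedSet (u 1) (v 1)) (twistedSet (u 1) (v 1)) (e, g)
      + diffCount (twistedSet (u 2) (v 2)) (twistedSet (u 2) (v 2)) (e, g)
      + diffCount (twistedSet (u 3) (v 3)) (twistedSet (u 3) (v 3)) (e, g))
      = 2 * (2 * Fintype.card F - 2) := by linarith
    omega

section Fourier

variable {F : Type*} [Field F] [Fintype F]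

/-- The Fourier transform of `u` with respect to the additive character `ψ`. -/
noncomputable def fourierSum (ψ : AddChar F ℂ) (u : F → ℂ) (b : F) : ℂ :=
  ∑ x, u x * ψ (b * x)

variable {ψ : AddChar F ℂ}

lemma fourierSum_add (u v : F → ℂ) (b : F) :
    fourierSum ψ (fun x => u x + v x) b = fourierSum ψ u b + fourierSum ψ v b := by
  simp [fourierSum, add_mul, Finset.sum_add_distrib]

lemma fourierSum_const_mul (a : ℂ) (u : F → ℂ) (b : F) :
    fourierSum ψ (fun x => a * u x) b = a * fourierSum ψ u b := by
  simp [fourierSum, mul_assoc, Finset.mul_sum]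

lemma fourierSum_sum {ι : Type*} (s : Finset ι) (u : ι → F → ℂ) (b : F) :
    fourierSum ψ (fun x => ∑ i ∈ s, u i x) b = ∑ i ∈ s, fourierSum ψ (u i) b := by
  simp only [fourierSum, Finset.sum_mul]
  exact Finset.sum_comm

lemma fourierSum_single [DecidableEq F] (a : ℂ) (b : F) :
    fourierSum ψ (fun x => if x = 0 then a else 0) b = a := by
  simp [fourierSum]

lemma fourierSum_zero_right (u : F → ℂ) : fourierSum ψ u 0 = ∑ x, u x := by
  simp [fourierSum]

lemma sum_addChar_mul [DecidableEq F] (hψ : ψ.IsPrimitive) (b : F) :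
    ∑ x, ψ (b * x) = if b = 0 then (Fintype.card F : ℂ) else 0 := by
  have := AddChar.sum_mulShift b hψ
  simp_rw [mul_comm b]
  rw [this]
  split_ifs <;> simp

lemma fourierSum_inversion [DecidableEq F] (hψ : ψ.IsPrimitive) (u : F → ℂ) (y : F) :
    ∑ b, fourierSum ψ u b * ψ (-(b * y)) = Fintype.card F * u y := by
  calc ∑ b, fourierSum ψ u b * ψ (-(b * y))
      = ∑ b, ∑ x, u x * ψ ((x - y) * b) := by
        refine Finset.sum_congr rfl fun b _ => ?_
        rw [fourierSum, Finset.sum_mul]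
        refine Finset.sum_congr rfl fun x _ => ?_
        rw [mul_assoc, ← AddChar.map_add_eq_mul]
        ring_nf
    _ = ∑ x, u x * ∑ b, ψ ((x - y) * b) := by
        rw [Finset.sum_comm]
        simp [Finset.mul_sum]
    _ = _ := by
        simp only [sum_addChar_mul hψ, sub_eq_zero]
        simp [mul_comm]

lemma eq_zero_of_fourierSum_eq_zero (hψ : ψ.IsPrimitive) (u : F → ℂ)
    (h : ∀ b, fourierSum ψ u b = 0) (y : F) : u y = 0 := by
  classical
  have := fourierSum_inversion hψ u y
  simpa [h] using this

lemma sum_fourierSum_mul_neg (hψ : ψ.IsPrimitive) (u : F → ℂ) :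
    ∑ b, fourierSum ψ u b * fourierSum ψ u (-b) = Fintype.card F * ∑ x, u x ^ 2 := by
  classical
  calc ∑ b, fourierSum ψ u b * fourierSum ψ u (-b)
      = ∑ b, ∑ y, u y * (fourierSum ψ u b * ψ (-(b * y))) := by
        refine Finset.sum_congr rfl fun b _ => ?_
        conv_lhs => rw [fourierSum.eq_def ψ u (-b), Finset.mul_sum]
        refine Finset.sum_congr rfl fun y _ => ?_
        rw [neg_mul]; ring
    _ = ∑ y, u y * ∑ b, fourierSum ψ u b * ψ (-(b * y)) := by
        rw [Finset.sum_comm]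
        simp [Finset.mul_sum]
    _ = _ := by
        simp only [fourierSum_inversion hψ, Finset.mul_sum]
        exact Finset.sum_congr rfl fun y _ => by ring

lemma fourierSum_autocorr (u : F → ℤ) (b : F) :
    fourierSum ψ (fun g => (autocorr u g : ℂ)) b
      = fourierSum ψ (fun x => (u x : ℂ)) b * fourierSum ψ (fun x => (u x : ℂ)) (-b) := by
  rw [fourierSum, fourierSum.eq_def ψ _ (-b), Finset.mul_sum]
  simp only [autocorr, Int.cast_sum, Finset.sum_mul, Int.cast_mul]
  rw [Finset.sum_comm]
  refine Finset.sum_congr rfl fun x _ => ?_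
  conv_rhs => rw [fourierSum, Finset.sum_mul, ← Equiv.sum_comp (Equiv.addLeft x)]
  refine Finset.sum_congr rfl fun g _ => ?_
  rw [Equiv.coe_addLeft, show ψ (b * (x + g)) = ψ (b * x) * ψ (b * g) by
    rw [← AddChar.map_add_eq_mul, mul_add]]
  have : ψ (b * x) * ψ (-b * x) = 1 := by
    rw [← AddChar.map_add_eq_mul]; simp
  linear_combination (-(u (x + g) : ℂ) * u x * ψ (b * g)) * this

lemma sum_autocorr_eq_of_fourierSum [DecidableEq F] {ι : Type*} [Fintype ι] (hψ : ψ.IsPrimitive)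
    (u : ι → F → ℤ) (N c : ℤ)
    (h : ∀ b, ∑ i, fourierSum ψ (fun x => (u i x : ℂ)) b * fourierSum ψ (fun x => (u i x : ℂ)) (-b)
      = N + if b = 0 then (c * Fintype.card F : ℂ) else 0) (g : F) :
    ∑ i, autocorr (u i) g = (if g = 0 then N else 0) + c := by
  have key := eq_zero_of_fourierSum_eq_zero hψ
    (fun g => (∑ i, (autocorr (u i) g : ℂ)) + ((if g = 0 then (-N : ℂ) else 0) + (-c) * 1))
    (fun b => by
      rw [fourierSum_add, fourierSum_add, fourierSum_sum, fourierSum_single,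
        fourierSum_const_mul]
      simp only [fourierSum_autocorr, h]
      rw [show fourierSum ψ (fun _ => (1 : ℂ)) b = if b = 0 then (Fintype.card F : ℂ) else 0 by
        simp only [fourierSum, one_mul]; exact sum_addChar_mul hψ b]
      split_ifs <;> ring) g
  have : ((∑ i, autocorr (u i) g : ℤ) : ℂ) = (((if g = 0 then N else 0) + c : ℤ) : ℂ) := by
    push_cast
    split_ifs at key ⊢
    · linear_combination key
    · linear_combination key
  exact_mod_cast this

end Fourier

section Involution

variable {F : Type*} [Field F] [Fintype F] {ψ : AddChar F ℂ} {φ : F →+* F}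

omit [Fintype F] in
lemma addChar_mul_eq_one_iff (h2 : (2 : F) ≠ 0) (hφ : ∀ x, φ (φ x) = x) (hψ : ψ ≠ 1)
    (hψφ : ∀ x, ψ (φ x) = ψ x) (y : F) :
    (∀ c, φ c = c → ψ (c * y) = 1) ↔ φ y = -y := by
  have h2' : φ 2⁻¹ = (2⁻¹ : F) := by rw [map_inv₀, map_ofNat φ 2]
  have htwo : (2⁻¹ : F) + 2⁻¹ = 1 := by rw [← two_mul, mul_inv_cancel₀ h2]
  constructor
  · intro h
    by_contra hne
    have ht : y + φ y ≠ 0 := fun h0 => hne (by rw [eq_neg_iff_add_eq_zero, add_comm]; exact h0)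
    have hfix : φ (y + φ y) = y + φ y := by rw [map_add, hφ, add_comm]
    have hK : ∀ c, φ c = c → ψ c = 1 := by
      intro c hc
      have hc' : φ (c * (y + φ y)⁻¹) = c * (y + φ y)⁻¹ := by
        rw [map_mul, map_inv₀, hfix, hc]
      have h1 := h _ hc'
      have h3 : ψ (c * (y + φ y)⁻¹ * φ y) = 1 := by
        rw [← h1, ← hψφ (c * (y + φ y)⁻¹ * y), map_mul φ _ y, hc']
      have := congrArg₂ (· * ·) h1 h3
      simp only [← AddChar.map_add_eq_mul, ← mul_add, mul_one] at this
      rwa [mul_assoc, inv_mul_cancel₀ ht, mul_one] at this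
    refine hψ (DFunLike.ext _ _ fun x => ?_)
    have hx := hK (2⁻¹ * x + φ (2⁻¹ * x)) (by rw [map_add, hφ, add_comm])
    rw [AddChar.map_add_eq_mul, hψφ, ← AddChar.map_add_eq_mul, ← add_mul, htwo, one_mul] at hx
    simpa using hx
  · intro hy c hc
    have h1 : ψ (2⁻¹ * (c * y)) = ψ (-(2⁻¹ * (c * y))) := by
      rw [← hψφ]
      rw [map_mul φ, map_mul φ, h2', hc, hy]
      ring_nf
    have : ψ (2⁻¹ * (c * y)) * ψ (2⁻¹ * (c * y)) = 1 := by
      nth_rewrite 2 [h1]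
      rw [← AddChar.map_add_eq_mul]; simp
    rwa [← AddChar.map_add_eq_mul, ← add_mul, htwo, one_mul] at this

variable [DecidableEq F]

lemma sum_addChar_fixed (h2 : (2 : F) ≠ 0) (hφ : ∀ x, φ (φ x) = x) (hψ : ψ ≠ 1)
    (hψφ : ∀ x, ψ (φ x) = ψ x) (y : F) :
    ∑ c with φ c = c, ψ (c * y) = if φ y = -y then ((univ.filter fun c => φ c = c).card : ℂ)
      else 0 := by
  split_ifs with hy
  · rw [Finset.sum_congr rfl fun c hc =>
      (addChar_mul_eq_one_iff h2 hφ hψ hψφ y).2 hy c (by simpa using hc)]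
    simp
  · have := (addChar_mul_eq_one_iff h2 hφ hψ hψφ y).not.2 hy
    push Not at this
    obtain ⟨d, hd, hd1⟩ := this
    have hsum : ψ (d * y) * ∑ c with φ c = c, ψ (c * y) = ∑ c with φ c = c, ψ (c * y) := by
      rw [Finset.mul_sum]
      refine Finset.sum_bij' (fun c _ => d + c) (fun c _ => c - d) ?_ ?_ ?_ ?_ ?_
      · intro c hc; simp at hc ⊢; rw [hd, hc]
      · intro c hc; simp at hc ⊢; rw [hd, hc]
      · intro c _; simp
      · intro c _; simp
      · intro c _; rw [← AddChar.map_add_eq_mul, add_mul]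
    have h0 : (ψ (d * y) - 1) * ∑ c with φ c = c, ψ (c * y) = 0 := by
      rw [sub_mul, hsum, one_mul, sub_self]
    exact (mul_eq_zero.1 h0).resolve_left (sub_ne_zero.2 hd1)

/-- The Fourier transform of a function which is constant on the punctured lines through the
origin over the fixed field of an involution. -/
lemma fourierSum_of_fixed_invariant (h2 : (2 : F) ≠ 0) (hφ : ∀ x, φ (φ x) = x) (hψ : ψ ≠ 1)
    (hψφ : ∀ x, ψ (φ x) = ψ x) {q : ℕ} (hq : (univ.filter fun c => φ c = c).card = q)
    (hq1 : 1 < q) {t : F} (ht : t ≠ 0) (hφt : φ t = -t) {f : F → ℂ} (hf0 : f 0 = 0)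
    (hf : ∀ c x, c ≠ 0 → φ c = c → f (c * x) = f x) {s : ℂ}
    (hs : ∑ x, f x = (q - 1) * s) {b : F} (hb : b ≠ 0) :
    fourierSum ψ f b = q * f (t / b) - s := by
  have hK : (univ.filter fun c => φ c = c)
      = insert 0 (univ.filter fun c => c ≠ 0 ∧ φ c = c) := by
    ext c; by_cases hc : c = 0 <;> simp [hc]
  have hcard : (univ.filter fun c => c ≠ 0 ∧ φ c = c).card + 1 = q := by
    rw [← hq, hK, Finset.card_insert_of_notMem (by simp)]
  have hcard' : ((univ.filter fun c => c ≠ 0 ∧ φ c = c).card : ℂ) = q - 1 := by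
    rw [← hcard]; push_cast; ring
  have hscale : ∀ c, c ≠ 0 → φ c = c → ∑ x, f x * ψ (c * (b * x)) = fourierSum ψ f b := by
    intro c hc hφc
    conv_rhs => rw [fourierSum, ← Equiv.sum_comp (Equiv.mulLeft₀ c hc)]
    refine Finset.sum_congr rfl fun x _ => ?_
    rw [show Equiv.mulLeft₀ c hc x = c * x from rfl, hf c x hc hφc]
    congr 2
    ring
  have hleft : ∑ c with φ c = c, ∑ x, f x * ψ (c * (b * x))
      = (q - 1) * s + (q - 1) * fourierSum ψ f b := by
    rw [hK, Finset.sum_insert (by simp)]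
    rw [Finset.sum_congr rfl fun c hc => hscale c (by simp at hc; exact hc.1)
      (by simp at hc; exact hc.2)]
    simp [hs, hcard']
  have hright : ∑ c with φ c = c, ∑ x, f x * ψ (c * (b * x))
      = q * ((q - 1) * f (t / b)) := by
    rw [Finset.sum_comm]
    simp only [← Finset.mul_sum, sum_addChar_fixed h2 hφ hψ hψφ, hq]
    have : ∑ x, f x * (if φ (b * x) = -(b * x) then (q : ℂ) else 0)
        = q * ∑ x with φ (b * x) = -(b * x), f x := by
      rw [Finset.sum_filter, Finset.mul_sum]
      refine Finset.sum_congr rfl fun x _ => ?_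
      split_ifs <;> ring
    rw [this]
    congr 1
    have himg : ∑ x with φ (b * x) = -(b * x), f x
        = ∑ c with φ c = c, f (c * (t / b)) := by
      refine Finset.sum_bij' (fun x _ => b * x / t) (fun c _ => c * (t / b)) ?_ ?_ ?_ ?_ ?_
      · intro x hx
        simp only [Finset.mem_filter, Finset.mem_univ, true_and] at hx ⊢
        rw [map_div₀, hx, hφt, neg_div_neg_eq]
      · intro c hc
        simp only [Finset.mem_filter, Finset.mem_univ, true_and] at hc ⊢
        rw [show b * (c * (t / b)) = c * t by field_simp, map_mul, hc, hφt]
        ring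
      · intro x _; field_simp
      · intro c _; field_simp
      · intro x _; congr 1; field_simp
    rw [himg, hK, Finset.sum_insert (by simp),
      Finset.sum_congr rfl fun c hc => hf c (t / b) (by simp at hc; exact hc.1)
        (by simp at hc; exact hc.2)]
    simp [hf0, hcard']
  have hq0 : (q : ℂ) - 1 ≠ 0 := by
    rw [sub_ne_zero]; exact_mod_cast hq1.ne'
  refine mul_left_cancel₀ hq0 ?_
  linear_combination hright - hleft

/-- The fixed field of a nontrivial involution has index two. -/
lemma card_fixed_sq (h2 : (2 : F) ≠ 0) (hφ : ∀ x, φ (φ x) = x) {t : F} (ht : t ≠ 0)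
    (hφt : φ t = -t) : (univ.filter fun c => φ c = c).card ^ 2 = Fintype.card F := by
  have htwo : (2⁻¹ : F) + 2⁻¹ = 1 := by rw [← two_mul, mul_inv_cancel₀ h2]
  rw [sq, ← Finset.card_product, ← Finset.card_univ]
  refine Finset.card_bij' (fun p _ => p.1 + p.2 * t)
    (fun x _ => (2⁻¹ * (x + φ x), 2⁻¹ * (x - φ x) / t)) ?_ ?_ ?_ ?_
  · intro p _; simp
  · intro x _
    simp only [Finset.mem_product, Finset.mem_filter, Finset.mem_univ, true_and]
    constructor
    · rw [map_mul, map_add, hφ, map_inv₀, map_ofNat φ 2, add_comm]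
    · rw [map_div₀, map_mul, map_sub, hφ, map_inv₀, map_ofNat φ 2, hφt]
      field_simp
      ring
  · rintro ⟨c, d⟩ hp
    simp only [Finset.mem_product, Finset.mem_filter, Finset.mem_univ, true_and] at hp
    simp only [map_add, map_mul, hp.1, hp.2, hφt, Prod.mk.injEq]
    constructor <;> field_simp <;> ring
  · intro x _
    field_simp
    ring

end Involution

section Octic

/-- The function on `ℤ/8` supported on `{0, 4}` with values `1` and `-1`. -/
def octicSign (j : ZMod 8) : ℤ := if j = 0 then 1 else if j = 4 then -1 else 0

/-- The sign `1` on `{0, 1, 2, 3}` and `-1` on `{4, 5, 6, 7}`. -/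
def halfSign (j : ZMod 8) : ℤ := if j.val < 4 then 1 else -1

/-- Reduction from `ℤ/8` to residues modulo `4`. -/
def quarticClass (j : ZMod 8) : Fin 4 := ⟨j.val % 4, Nat.mod_lt _ (by norm_num)⟩

lemma quarticClass_add_four (j : ZMod 8) : quarticClass (j + 4) = quarticClass j := by
  revert j; decide

lemma halfSign_mul_eq_sum (O : Fin 4 → ℤ) (j : ZMod 8) :
    halfSign j * O (quarticClass j) = ∑ k : Fin 4, O k * octicSign (j - (k.val : ZMod 8)) := by
  have h : ∀ (j : ZMod 8) (k : Fin 4), octicSign (j - (k.val : ZMod 8))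
      = if k = quarticClass j then halfSign j else 0 := by decide
  simp [h, mul_comm]

variable {F : Type*} [Field F] [Fintype F] [DecidableEq F]

/-- The difference of the indicator functions of two opposite octic classes. -/
def octicFun (κ : F → ZMod 8) (k : ZMod 8) (x : F) : ℂ :=
  if x = 0 then 0 else (octicSign (κ x - k) : ℂ)

variable {ψ : AddChar F ℂ} {κ : F → ZMod 8}

lemma fourierSum_octicFun (hκ : ∀ x y, x ≠ 0 → y ≠ 0 → κ (x * y) = κ x + κ y) (k : ZMod 8)
    {b : F} (hb : b ≠ 0) :
    fourierSum ψ (octicFun κ k) b = fourierSum ψ (octicFun κ (k + κ b)) 1 := by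
  conv_rhs => rw [fourierSum, ← Equiv.sum_comp (Equiv.mulLeft₀ b hb)]
  refine Finset.sum_congr rfl fun x _ => ?_
  rw [show Equiv.mulLeft₀ b hb x = b * x from rfl, one_mul]
  by_cases hx : x = 0
  · simp [octicFun, hx]
  · simp only [octicFun, hx, mul_ne_zero hb hx, if_false, hκ b x hb hx]
    congr 3
    ring_nf

omit [Fintype F] in
lemma octicFun_add_four (k : ZMod 8) (x : F) : octicFun κ (k + 4) x = -octicFun κ k x := by
  have h : ∀ j k : ZMod 8, octicSign (j - (k + 4)) = -octicSign (j - k) := by decide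
  by_cases hx : x = 0 <;> simp [octicFun, hx, h]

lemma fourierSum_octicFun_add_four (k : ZMod 8) (b : F) :
    fourierSum ψ (octicFun κ (k + 4)) b = -fourierSum ψ (octicFun κ k) b := by
  simp [fourierSum, octicFun_add_four]

lemma sum_octicFun (hκ : ∀ x y, x ≠ 0 → y ≠ 0 → κ (x * y) = κ x + κ y) (hneg : κ (-1) = 4)
    (k : ZMod 8) : ∑ x, octicFun κ k x = 0 := by
  have h1 : ∑ x, octicFun κ k (-x) = ∑ x, octicFun κ k x :=
    Equiv.sum_comp (Equiv.neg F) (octicFun κ k)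
  have h2 : ∀ x, octicFun κ k (-x) = -octicFun κ k x := by
    intro x
    have h : ∀ j k : ZMod 8, octicSign (4 + j - k) = -octicSign (j - k) := by decide
    by_cases hx : x = 0
    · simp [octicFun, hx]
    · have hκx : κ (-x) = 4 + κ x := by rw [← neg_one_mul, hκ _ _ (by simp) hx, hneg]
      simp [octicFun, hx, hκx, h]
  simp only [h2, Finset.sum_neg_distrib] at h1
  linear_combination (-1 / 2 : ℂ) * h1

variable {φ : F →+* F}

lemma fourierSum_octicFun_three_mul (hφ : ∀ x, φ (φ x) = x) (hψφ : ∀ x, ψ (φ x) = ψ x)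
    (hκφ : ∀ x, x ≠ 0 → κ (φ x) = 3 * κ x) (k : ZMod 8) :
    fourierSum ψ (octicFun κ (3 * k)) 1 = fourierSum ψ (octicFun κ k) 1 := by
  have hbij : Function.Bijective φ := Function.Involutive.bijective hφ
  rw [fourierSum, ← Equiv.sum_comp (Equiv.ofBijective φ hbij)]
  refine Finset.sum_congr rfl fun x _ => ?_
  rw [Equiv.ofBijective_apply, one_mul, one_mul, hψφ]
  by_cases hx : x = 0
  · simp [octicFun, hx]
  · have h : ∀ j k : ZMod 8, octicSign (3 * j - 3 * k) = octicSign (j - k) := by decide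
    simp [octicFun, hx, hκφ x hx, h]

omit [Fintype F] in
lemma sum_octicFun_sq (x : F) :
    ∑ k : ZMod 8, octicFun κ k x ^ 2 = if x = 0 then 0 else 2 := by
  have h : ∀ j : ZMod 8, ∑ k : ZMod 8, octicSign (j - k) ^ 2 = 2 := by decide
  by_cases hx : x = 0
  · simp [octicFun, hx]
  · simp only [octicFun, hx, if_false]
    exact_mod_cast h (κ x)

lemma sum_fourierSum_octicFun_sq (hψ : ψ.IsPrimitive)
    (hκ : ∀ x y, x ≠ 0 → y ≠ 0 → κ (x * y) = κ x + κ y) (hneg : κ (-1) = 4) :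
    ∑ k : ZMod 8, fourierSum ψ (octicFun κ k) 1 ^ 2 = -2 * Fintype.card F := by
  have hcard : (Fintype.card F : ℂ) - 1 ≠ 0 := by
    rw [sub_ne_zero]; exact_mod_cast (Fintype.one_lt_card (α := F)).ne'
  have hne : ∑ x : F, (if x = 0 then (0 : ℂ) else 2) = 2 * (Fintype.card F - 1) := by
    have : ∀ x : F, (if x = 0 then (0 : ℂ) else 2) = 2 - if x = 0 then 2 else 0 := by
      intro x; split_ifs <;> ring
    simp only [this, Finset.sum_sub_distrib]
    simp
    ring
  have hpar : ∑ k : ZMod 8, ∑ b, fourierSum ψ (octicFun κ k) b * fourierSum ψ (octicFun κ k) (-b)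
      = Fintype.card F * (2 * (Fintype.card F - 1)) := by
    simp only [sum_fourierSum_mul_neg hψ, ← Finset.mul_sum]
    rw [Finset.sum_comm]
    simp only [sum_octicFun_sq, hne]
  have hval : ∀ b, ∑ k : ZMod 8,
      fourierSum ψ (octicFun κ k) b * fourierSum ψ (octicFun κ k) (-b)
      = (if b = 0 then 0 else 2)
        * (-(1 / 2) * ∑ k : ZMod 8, fourierSum ψ (octicFun κ k) 1 ^ 2) := by
    intro b
    by_cases hb : b = 0
    · simp [hb, fourierSum_zero_right, sum_octicFun hκ hneg]
    · have h4 : κ (-b) = κ b + 4 := by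
        rw [← neg_one_mul, hκ _ _ (by simp) hb, hneg, add_comm]
      simp only [fourierSum_octicFun hκ _ hb, fourierSum_octicFun hκ _ (neg_ne_zero.2 hb), h4,
        ← add_assoc, fourierSum_octicFun_add_four]
      rw [← Equiv.sum_comp (Equiv.addRight (κ b)) fun k => fourierSum ψ (octicFun κ k) 1 ^ 2]
      simp only [hb, if_false, Finset.mul_sum]
      refine Finset.sum_congr rfl fun k _ => ?_
      rw [Equiv.coe_addRight]
      ring
  rw [Finset.sum_comm] at hpar
  simp only [hval, ← Finset.sum_mul, hne] at hpar
  refine mul_left_cancel₀ hcard ?_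
  linear_combination -hpar

/-- The Fourier transform of a function combining a part which is constant on punctured lines
over the fixed field of `φ` with an odd part depending on the octic class only. -/
lemma fourierSum_mixed (h2 : (2 : F) ≠ 0) (hφ : ∀ x, φ (φ x) = x) (hψ : ψ ≠ 1)
    (hψφ : ∀ x, ψ (φ x) = ψ x) {q : ℕ} (hq : (univ.filter fun c => φ c = c).card = q)
    (hq1 : 1 < q) {t : F} (ht : t ≠ 0) (hφt : φ t = -t)
    (hκ : ∀ x y, x ≠ 0 → y ≠ 0 → κ (x * y) = κ x + κ y)
    (hκK : ∀ c, c ≠ 0 → φ c = c → κ c = 0 ∨ κ c = 4) {ε : F → ℤ}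
    (hεK : ∀ c x, c ≠ 0 → x ≠ 0 → φ c = c → ε (c * x) = ε x)
    (Y O : Fin 4 → ℤ) (v : ℤ)
    (hY : ∑ x, (if x = 0 then 0 else ε x * Y (quarticClass (κ x))) = (q - 1) * ∑ k, Y k)
    {u : F → ℤ} (hu0 : u 0 = v)
    (hu : ∀ x, x ≠ 0 → 2 * u x = ε x * Y (quarticClass (κ x))
      + halfSign (κ x) * O (quarticClass (κ x)))
    {b : F} (hb : b ≠ 0) :
    2 * fourierSum ψ (fun x => (u x : ℂ)) b
      = (2 * v + (q * (ε (t / b) * Y (quarticClass (κ (t / b)))) - ∑ k, (Y k : ℂ)))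
        + ∑ k : Fin 4, (O k : ℂ) * fourierSum ψ (octicFun κ ((k.val : ZMod 8) + κ b)) 1 := by
  set f : F → ℂ := fun x => ((if x = 0 then 0 else ε x * Y (quarticClass (κ x)) : ℤ) : ℂ) with hf
  have hfun : ∀ x, (2 : ℂ) * u x = ((if x = 0 then (2 * v : ℂ) else 0) + f x)
      + ∑ k : Fin 4, (O k : ℂ) * octicFun κ (k.val : ZMod 8) x := by
    intro x
    by_cases hx : x = 0
    · simp [hx, hu0, hf, octicFun]
    · have := hu x hx
      rw [halfSign_mul_eq_sum] at this
      have h' : ((2 * u x : ℤ) : ℂ) = _ := congrArg (Int.cast : ℤ → ℂ) this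
      push_cast at h'
      simp only [hf, hx, octicFun, if_false, h']
      push_cast
      ring
  have hfline : fourierSum ψ f b = q * f (t / b) - ∑ k, (Y k : ℂ) := by
    refine fourierSum_of_fixed_invariant h2 hφ hψ hψφ hq hq1 ht hφt (by simp [hf]) ?_ ?_ hb
    · intro c x hc hφc
      by_cases hx : x = 0
      · simp [hx]
      · have hcl : quarticClass (κ c + κ x) = quarticClass (κ x) := by
          rcases hκK c hc hφc with h | h
          · rw [h, zero_add]
          · rw [h, add_comm, quarticClass_add_four]
        simp only [hf, mul_ne_zero hc hx, hx, if_false, hεK c x hc hx hφc, hκ c x hc hx, hcl]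
    · simp only [hf]
      rw [← Int.cast_sum, hY]
      push_cast
      ring
  rw [← fourierSum_const_mul]
  simp only [hfun]
  rw [fourierSum_add, fourierSum_add, fourierSum_single, fourierSum_sum, hfline]
  simp only [fourierSum_const_mul, fourierSum_octicFun hκ _ hb]
  have htb : t / b ≠ 0 := div_ne_zero ht hb
  simp [hf, htb]

lemma sum_mixed (hκ : ∀ x y, x ≠ 0 → y ≠ 0 → κ (x * y) = κ x + κ y) (hneg : κ (-1) = 4)
    {q : ℕ} {ε : F → ℤ} (Y O : Fin 4 → ℤ) (v : ℤ)
    (hY : ∑ x, (if x = 0 then 0 else ε x * Y (quarticClass (κ x))) = (q - 1) * ∑ k, Y k)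
    {u : F → ℤ} (hu0 : u 0 = v)
    (hu : ∀ x, x ≠ 0 → 2 * u x = ε x * Y (quarticClass (κ x))
      + halfSign (κ x) * O (quarticClass (κ x))) :
    2 * ∑ x, u x = 2 * v + (q - 1) * ∑ k, Y k := by
  have hfun : ∀ x, 2 * u x = ((if x = 0 then 2 * v else 0)
      + (if x = 0 then 0 else ε x * Y (quarticClass (κ x))))
      + ∑ k : Fin 4, O k * (if x = 0 then 0 else octicSign (κ x - (k.val : ZMod 8))) := by
    intro x
    by_cases hx : x = 0
    · simp [hx, hu0]
    · have := hu x hx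
      rw [halfSign_mul_eq_sum] at this
      simp [hx, this]
  have hodd : ∀ k : ZMod 8, ∑ x, (if x = 0 then 0 else octicSign (κ x - k)) = 0 := by
    intro k
    have := sum_octicFun hκ hneg k
    simp only [octicFun] at this
    exact_mod_cast this
  rw [Finset.mul_sum]
  simp only [hfun, Finset.sum_add_distrib, hY]
  rw [Finset.sum_comm]
  simp only [← Finset.mul_sum, hodd]
  simp

end Octic

section Logarithm

lemma two_ne_zero_of_odd_card {F : Type*} [Field F] [Fintype F] (h : Odd (Fintype.card F)) :
    (2 : F) ≠ 0 :=
  Ring.two_ne_zero fun h2 => Nat.not_even_iff_odd.2 h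
    (Nat.even_iff.2 (FiniteField.even_card_of_char_two h2))

lemma sum_neg_one_pow_div_four (Y : Fin 4 → ℤ) (m : ℕ) :
    ∑ i ∈ range (4 * m), (-1) ^ (i / 4) * Y ⟨i % 4, Nat.mod_lt _ (by norm_num)⟩
      = if Even m then 0 else ∑ k, Y k := by
  induction m with
  | zero => simp
  | succ m ih =>
    have h4 : ∀ j < 4, (4 * m + j) / 4 = m ∧ (4 * m + j) % 4 = j := by omega
    have h0 := h4 0 (by norm_num)
    have h1 := h4 1 (by norm_num)
    have h2 := h4 2 (by norm_num)
    have h3 := h4 3 (by norm_num)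
    rw [mul_add, Finset.sum_range_add, ih, Fin.sum_univ_four]
    simp only [mul_one, Finset.sum_range_succ, Finset.sum_range_zero, h0, h1, h2, h3]
    by_cases hm : Even m
    · have : ¬ Even (m + 1) := by simpa [Nat.even_add_one] using hm
      simp [hm, this, hm.neg_one_pow]
    · have : Even (m + 1) := by simpa [Nat.even_add_one] using hm
      simp only [hm, this, if_false, if_true, (Nat.not_even_iff_odd.1 hm).neg_one_pow]
      simp
      ring

lemma sum_range_mul_of_mod (g : ℕ → ℤ) (a r : ℕ) :
    ∑ i ∈ range (a * r), g (i % a) = r * ∑ i ∈ range a, g i := by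
  induction r with
  | zero => simp
  | succ r ih =>
    rw [mul_add, mul_one, Finset.sum_range_add, ih]
    have : ∑ i ∈ range a, g ((a * r + i) % a) = ∑ i ∈ range a, g i := by
      refine Finset.sum_congr rfl fun i hi => ?_
      rw [Nat.mul_add_mod, Nat.mod_eq_of_lt (Finset.mem_range.1 hi)]
    rw [this]
    push_cast
    ring

lemma quarticClass_natCast (i : ℕ) :
    quarticClass (i : ZMod 8) = ⟨i % 4, Nat.mod_lt _ (by norm_num)⟩ := by
  simp only [quarticClass, ZMod.val_natCast, Fin.mk.injEq]
  omega

/-- A field of order `q ^ 2` with `q ≡ 3 (mod 8)` carries an octic class function together with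
a sign function that is constant on punctured lines over the subfield of order `q` and has
balanced sums over the quartic classes. -/
lemma exists_octicClass_and_sign {F : Type*} [Field F] [Fintype F] [DecidableEq F] {q : ℕ}
    (hF : Fintype.card F = q ^ 2) (hq : q % 8 = 3) :
    ∃ (κ : F → ZMod 8) (ε : F → ℤ),
      (∀ x y, x ≠ 0 → y ≠ 0 → κ (x * y) = κ x + κ y) ∧ κ (-1) = 4 ∧
      (∀ c, c ≠ 0 → c ^ q = c → κ c = 0 ∨ κ c = 4) ∧
      (∀ x, ε x = 1 ∨ ε x = -1) ∧
      (∀ c x, c ≠ 0 → x ≠ 0 → c ^ q = c → ε (c * x) = ε x) ∧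
      ∀ Y : Fin 4 → ℤ, ∑ x, (if x = 0 then 0 else ε x * Y (quarticClass (κ x)))
        = (q - 1) * ∑ k, Y k := by
  obtain ⟨a, rfl⟩ : ∃ a, q = 8 * a + 3 := ⟨q / 8, by omega⟩
  set n := (8 * a + 3) ^ 2 - 1 with hn
  have hn1 : n = 8 * (8 * a ^ 2 + 6 * a + 1) := by
    rw [hn]; refine Nat.sub_eq_of_eq_add ?_; ring
  have hn2 : n = (4 * (2 * a + 1)) * (8 * a + 2) := by rw [hn1]; ring
  obtain ⟨ω, hω⟩ := IsCyclic.exists_generator (α := Fˣ)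
  have hord : orderOf ω = n := by
    rw [orderOf_eq_card_of_forall_mem_zpowers hω, Nat.card_eq_fintype_card, Fintype.card_units, hF]
  have hpow : ∀ i j : ℕ, (ω : F) ^ i = ω ^ j ↔ i ≡ j [MOD n] := by
    intro i j
    rw [← hord, ← pow_eq_pow_iff_modEq, ← Units.val_pow_eq_pow_val, ← Units.val_pow_eq_pow_val,
      Units.val_inj]
  have hex : ∀ x : F, ∃ i < n, x ≠ 0 → (ω : F) ^ i = x := by
    intro x
    by_cases hx : x = 0
    · exact ⟨0, by omega, fun h => absurd hx h⟩
    · obtain ⟨i, hi⟩ := (mem_powers_iff_mem_zpowers.2 (hω (Units.mk0 x hx)))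
      refine ⟨i % n, Nat.mod_lt _ (by omega), fun _ => ?_⟩
      have hi' : (ω : F) ^ i = x := by
        rw [← Units.val_pow_eq_pow_val]; simpa using congrArg Units.val hi
      rw [← hi', hpow]
      exact Nat.mod_modEq _ _
  choose lg hlt hlg using hex
  have hmul : ∀ x y, x ≠ 0 → y ≠ 0 → lg (x * y) ≡ lg x + lg y [MOD n] := by
    intro x y hx hy
    rw [← hpow, hlg _ (mul_ne_zero hx hy), pow_add, hlg x hx, hlg y hy]
  have hfix : ∀ c, c ≠ 0 → c ^ (8 * a + 3) = c → 4 * (2 * a + 1) ∣ lg c := by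
    intro c hc h
    have h1 : lg c * (8 * a + 3) ≡ lg c [MOD n] := by
      rw [← hpow, pow_mul, hlg c hc, h]
    have h2 : n ∣ lg c * (8 * a + 3) - lg c :=
      (Nat.modEq_iff_dvd' (Nat.le_mul_of_pos_right _ (by omega))).1 h1.symm
    rw [hn2, show lg c * (8 * a + 3) - lg c = lg c * (8 * a + 2) by
      refine Nat.sub_eq_of_eq_add ?_; ring] at h2
    exact Nat.dvd_of_mul_dvd_mul_right (by omega) h2
  have hn8 : 8 ∣ n := ⟨_, hn1⟩
  have hnq : 4 * (2 * a + 1) ∣ n := ⟨_, hn2⟩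
  refine ⟨fun x => (lg x : ZMod 8), fun x => (-1) ^ ((lg x % (4 * (2 * a + 1))) / 4),
    ?_, ?_, ?_, ?_, ?_, ?_⟩
  · intro x y hx hy
    have := (ZMod.natCast_eq_natCast_iff _ _ 8).2 ((hmul x y hx hy).of_dvd hn8)
    simpa using this
  · have h2 : (2 : F) ≠ 0 := two_ne_zero_of_odd_card (by
      rw [hF]; exact (Nat.odd_iff.2 (by omega)).pow)
    have hne : lg (-1 : F) ≠ 0 := by
      intro h0
      have := hlg (-1 : F) (by simp)
      rw [h0, pow_zero] at this
      exact h2 (by linear_combination this)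
    have hsq : lg (-1 : F) + lg (-1 : F) ≡ 0 [MOD n] := by
      rw [← hpow, pow_add, hlg (-1 : F) (by simp)]; simp
    have hlt' := hlt (-1 : F)
    obtain ⟨d, hd⟩ := (Nat.modEq_zero_iff_dvd).1 hsq
    have hd1 : d = 1 := by nlinarith [Nat.pos_of_ne_zero hne]
    have hval : lg (-1 : F) = 8 * (4 * a ^ 2 + 3 * a) + 4 := by
      rw [hd1, hn1] at hd; omega
    show ((lg (-1 : F) : ℕ) : ZMod 8) = 4
    rw [hval]
    push_cast
    rw [show (8 : ZMod 8) = 0 from rfl, zero_mul, zero_add]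
  · intro c hc h
    obtain ⟨d, hd⟩ := hfix c hc h
    have : lg c % 8 = 0 ∨ lg c % 8 = 4 := by
      have : 4 ∣ lg c := ⟨(2 * a + 1) * d, by rw [hd]; ring⟩
      omega
    refine this.imp (fun h => ?_) (fun h => ?_) <;>
    · show ((lg c : ℕ) : ZMod 8) = _
      rw [← ZMod.natCast_mod, h]; rfl
  · intro x
    exact neg_one_pow_eq_or ℤ _
  · intro c x hc hx h
    have h1 := (hmul c x hc hx).of_dvd hnq
    have h2 : lg c + lg x ≡ lg x [MOD 4 * (2 * a + 1)] := by
      simpa using ((Nat.modEq_zero_iff_dvd.2 (hfix c hc h)).add_right (lg x))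
    have h3 : lg (c * x) % (4 * (2 * a + 1)) = lg x % (4 * (2 * a + 1)) := h1.trans h2
    simp only [h3]
  · intro Y
    set g : ℕ → ℤ := fun i => (-1) ^ (i / 4) * Y ⟨i % 4, Nat.mod_lt _ (by norm_num)⟩ with hg
    have hterm : ∀ x : F, (-1) ^ ((lg x % (4 * (2 * a + 1))) / 4)
        * Y (quarticClass (lg x : ZMod 8)) = g (lg x % (4 * (2 * a + 1))) := by
      intro x
      simp only [hg, quarticClass_natCast]
      congr 3
      rw [Nat.mod_mul_right_mod]
    have hbij : ∑ x : F, (if x = 0 then 0 else g (lg x % (4 * (2 * a + 1))))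
        = ∑ i ∈ range n, g (i % (4 * (2 * a + 1))) := by
      have : ∀ x : F, (if x = 0 then 0 else g (lg x % (4 * (2 * a + 1))))
          = if x ≠ 0 then g (lg x % (4 * (2 * a + 1))) else 0 := by
        intro x; by_cases hx : x = 0 <;> simp [hx]
      simp only [this]
      rw [← Finset.sum_filter]
      refine Finset.sum_bij' (fun x _ => lg x) (fun i _ => (ω : F) ^ i) ?_ ?_ ?_ ?_ ?_
      · intro x _; exact Finset.mem_range.2 (hlt x)
      · intro i _; simp
      · intro x hx; exact hlg x (by simpa using hx)
      · intro i hi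
        have h := (hpow _ _).1 (hlg ((ω : F) ^ i) (by simp))
        exact Nat.ModEq.eq_of_lt_of_lt h (hlt _) (Finset.mem_range.1 hi)
      · intro x _; rfl
    simp only [hterm]
    rw [hbij, hn2, sum_range_mul_of_mod, sum_neg_one_pow_div_four, if_neg]
    · push_cast; ring
    · simp

end Logarithm

section Combination

lemma exists_frobenius {F : Type*} [Field F] [Fintype F] {q : ℕ} (hq : IsPrimePow q)
    (hF : Fintype.card F = q ^ 2) : ∃ φ : F →+* F, ∀ x, φ x = x ^ q := by
  obtain ⟨p, n, hp, -, rfl⟩ := (isPrimePow_nat_iff q).1 hq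
  have : Fact p.Prime := ⟨hp⟩
  have : CharP F p := charP_of_card_eq_prime_pow (by rw [hF, ← pow_mul])
  exact ⟨iterateFrobenius F p n, iterateFrobenius_def p n⟩

lemma exists_addChar_invariant {F : Type*} [Field F] [Fintype F] (h2 : (2 : F) ≠ 0)
    {φ : F →+* F} (hφ : ∀ x, φ (φ x) = x) :
    ∃ ψ : AddChar F ℂ, ψ ≠ 1 ∧ ∀ x, ψ (φ x) = ψ x := by
  obtain ⟨ψ₀, hψ₀⟩ : ∃ ψ₀ : AddChar F ℂ, ψ₀.IsPrimitive :=
    ⟨AddChar.FiniteField.primitiveChar_to_Complex F,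
      AddChar.FiniteField.primitiveChar_to_Complex_isPrimitive F⟩
  obtain ⟨a, ha⟩ := (AddChar.ne_one_iff).1 (hψ₀ h2)
  rw [AddChar.mulShift_apply] at ha
  refine ⟨(ψ₀.mulShift a).compAddMonoidHom (AddMonoidHom.id F + φ.toAddMonoidHom), ?_, ?_⟩
  · refine AddChar.ne_one_iff.2 ⟨1, ?_⟩
    simpa [AddChar.mulShift_apply, mul_comm a, one_add_one_eq_two] using ha
  · intro x
    simp [AddChar.mulShift_apply, hφ, add_comm]

/-- The function on `ℤ/8` with values `1` on `{1, 3}` and `-1` on `{5, 7}`. -/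
def octicOddSign (j : ZMod 8) : ℤ := octicSign (j - 1) + octicSign (j - 3)

lemma eq_octicSign_mul_add {B : ZMod 8 → ℂ} (h4 : ∀ k, B (k + 4) = -B k)
    (h3 : ∀ k, B (3 * k) = B k) (k : ZMod 8) :
    B k = octicSign k * B 0 + octicOddSign k * B 1 := by
  have e3 : B 3 = B 1 := h3 1
  have e4 : B 4 = -B 0 := h4 0
  have e5 : B 5 = -B 1 := h4 1
  have e6 : B 6 = -B 2 := h4 2
  have e7 : B 7 = -B 3 := h4 3
  have e2 : B 2 = 0 := by
    have : B 6 = B 2 := h3 2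
    linear_combination (1 / 2 : ℂ) * (e6 - this)
  fin_cases k
  · change B 0 = ((1 : ℤ) : ℂ) * _ + ((0 : ℤ) : ℂ) * _
    simp
  · change B 1 = ((0 : ℤ) : ℂ) * _ + ((1 : ℤ) : ℂ) * _
    simp
  · change B 2 = ((0 : ℤ) : ℂ) * _ + ((0 : ℤ) : ℂ) * _
    simp [e2]
  · change B 3 = ((0 : ℤ) : ℂ) * _ + ((1 : ℤ) : ℂ) * _
    simp [e3]
  · change B 4 = ((-1 : ℤ) : ℂ) * _ + ((0 : ℤ) : ℂ) * _
    simp [e4]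
  · change B 5 = ((0 : ℤ) : ℂ) * _ + ((-1 : ℤ) : ℂ) * _
    simp [e5]
  · change B 6 = ((0 : ℤ) : ℂ) * _ + ((0 : ℤ) : ℂ) * _
    simp [e6, e2]
  · change B 7 = ((0 : ℤ) : ℂ) * _ + ((-1 : ℤ) : ℂ) * _
    simp [e7, e3]

lemma sq_add_two_mul_sq {B : ZMod 8 → ℂ} {N : ℂ} (h4 : ∀ k, B (k + 4) = -B k)
    (h3 : ∀ k, B (3 * k) = B k) (hN : ∑ k, B k ^ 2 = -2 * N) :
    B 0 ^ 2 + 2 * B 1 ^ 2 = -N := by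
  have e3 : B 3 = B 1 := h3 1
  have e4 : B 4 = -B 0 := h4 0
  have e5 : B 5 = -B 1 := h4 1
  have e6 : B 6 = -B 2 := h4 2
  have e7 : B 7 = -B 3 := h4 3
  have e2 : B 2 = 0 := by
    have : B 6 = B 2 := h3 2
    linear_combination (1 / 2 : ℂ) * (e6 - this)
  have h : ∑ k : ZMod 8, B k ^ 2 = B 0 ^ 2 + B 1 ^ 2 + B 2 ^ 2 + B 3 ^ 2 + B 4 ^ 2 + B 5 ^ 2
      + B 6 ^ 2 + B 7 ^ 2 := Fin.sum_univ_eight _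
  rw [hN, e7, e6, e5, e4, e3, e2] at h
  linear_combination -(1 / 2 : ℂ) * h

/-- Over a field of order `q ^ 2` with `q ≡ 3 (mod 8)` there are an octic class function, a sign
function and a primitive character for which the functions mixing a line part `Y` and an odd octic
part `O` have an explicit Fourier transform. -/
lemma exists_octicClass_fourierSum {F : Type*} [Field F] [Fintype F] [DecidableEq F] {q : ℕ}
    (hF : Fintype.card F = q ^ 2) (hq : IsPrimePow q) (hq3 : q % 8 = 3) :
    ∃ (κ : F → ZMod 8) (ε e : F → ℤ) (ψ : AddChar F ℂ) (x y : ℂ), ψ.IsPrimitive ∧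
      (∀ z, ε z = 1 ∨ ε z = -1) ∧ (∀ z, e z = 1 ∨ e z = -1) ∧ x ^ 2 + 2 * y ^ 2 = -(q : ℂ) ^ 2 ∧
      ∀ (Y O : Fin 4 → ℤ) (v : ℤ) (u : F → ℤ), u 0 = v →
        (∀ z, z ≠ 0 → 2 * u z = ε z * Y (quarticClass (κ z))
          + halfSign (κ z) * O (quarticClass (κ z))) →
        2 * ∑ z, u z = 2 * v + (q - 1) * ∑ k, Y k ∧
        ∀ b, b ≠ 0 → ∀ s : ℂ, ∀ b', (s = 1 ∧ b' = b) ∨ (s = -1 ∧ b' = -b) →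
          2 * fourierSum ψ (fun z => (u z : ℂ)) b'
            = ((2 * v - ∑ k, Y k : ℤ) + (q * e b : ℂ) * Y (quarticClass (2 - κ b)))
              + s * ((∑ k : Fin 4, O k * octicSign ((k.val : ZMod 8) + κ b) : ℤ) * x
                + (∑ k : Fin 4, O k * octicOddSign ((k.val : ZMod 8) + κ b) : ℤ) * y) := by
  have hq1 : 1 < q := hq.one_lt
  have h2 : (2 : F) ≠ 0 := two_ne_zero_of_odd_card (by
    rw [hF]; exact (Nat.odd_iff.2 (by omega)).pow)
  obtain ⟨φ, hφq⟩ := exists_frobenius hq hF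
  have hφ : ∀ x, φ (φ x) = x := by
    intro x
    rw [hφq, hφq, ← pow_mul, ← sq, ← hF, FiniteField.pow_card]
  obtain ⟨ψ, hψ, hψφ⟩ := exists_addChar_invariant h2 hφ
  obtain ⟨κ, ε, hκ, hneg, hκK, hε, hεK, hY⟩ := exists_octicClass_and_sign hF hq3
  simp only [← hφq] at hκK hεK
  have hκφ : ∀ x, x ≠ 0 → κ (φ x) = 3 * κ x := by
    intro x hx
    have h1 : κ 1 = 0 := by simpa using hκ 1 1 one_ne_zero one_ne_zero
    have : ∀ n : ℕ, κ (x ^ n) = n * κ x := by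
      intro n
      induction n with
      | zero => simp [h1]
      | succ n ih => rw [pow_succ, hκ _ _ (pow_ne_zero n hx) hx, ih]; push_cast; ring
    rw [hφq, this, ← ZMod.natCast_mod, hq3]
    rfl
  obtain ⟨z, hz⟩ : ∃ z, φ z ≠ z := by
    by_contra! hall
    have h := hY ![0, 1, 0, 0]
    rw [Finset.sum_eq_zero] at h
    · simp [Fin.sum_univ_four] at h
      omega
    · intro x _
      by_cases hx : x = 0
      · simp [hx]
      · have hj : ∀ j : ZMod 8, j = 0 ∨ j = 4 → (![0, 1, 0, 0] : Fin 4 → ℤ) (quarticClass j) = 0 := by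
          decide
        rw [if_neg hx, hj _ (hκK x hx (hall x)), mul_zero]
  set t := φ z - z with htdef
  have ht : t ≠ 0 := sub_ne_zero.2 hz
  have hφt : φ t = -t := by rw [htdef, map_sub, hφ, neg_sub]
  have hκneg : ∀ x, x ≠ 0 → κ (-x) = κ x + 4 := by
    intro x hx
    rw [← neg_one_mul, hκ _ _ (by simp) hx, hneg, add_comm]
  have hκt : κ t = 2 ∨ κ t = 6 := by
    have h := hκφ t ht
    rw [hφt, hκneg t ht] at h
    have : ∀ j : ZMod 8, j + 4 = 3 * j → j = 2 ∨ j = 6 := by decide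
    exact this _ h
  have hcard : (univ.filter fun c => φ c = c).card = q := by
    have := card_fixed_sq h2 hφ ht hφt
    rw [hF] at this
    exact Nat.pow_left_injective two_ne_zero this
  have hprim := AddChar.IsPrimitive.of_ne_one hψ
  set B : ZMod 8 → ℂ := fun k => fourierSum ψ (octicFun κ k) 1 with hB
  have hB4 : ∀ k, B (k + 4) = -B k := fun k => fourierSum_octicFun_add_four k 1
  have hB3 : ∀ k, B (3 * k) = B k := fun k => fourierSum_octicFun_three_mul hφ hψφ hκφ k
  have hBsum := sum_fourierSum_octicFun_sq hprim hκ hneg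
  refine ⟨κ, ε, fun b => ε (t / b), ψ, B 0, B 1, hprim, hε, fun b => hε _, ?_, ?_⟩
  · rw [sq_add_two_mul_sq hB4 hB3 hBsum, hF]
    push_cast
    rfl
  · intro Y O v u hu0 hu
    refine ⟨sum_mixed hκ hneg Y O v (hY Y) hu0 hu, fun b hb s b' hs => ?_⟩
    have hb' : b' ≠ 0 := by
      rcases hs with ⟨-, rfl⟩ | ⟨-, rfl⟩
      · exact hb
      · exact neg_ne_zero.2 hb
    have htb : ∀ b, b ≠ 0 → quarticClass (κ (t / b)) = quarticClass (2 - κ b) := by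
      intro b hb
      have h := hκ (t / b) b (div_ne_zero ht hb) hb
      rw [div_mul_cancel₀ _ hb] at h
      have hd : ∀ i j k : ZMod 8, (k = 2 ∨ k = 6) → k = i + j →
          quarticClass i = quarticClass (2 - j) := by decide
      exact hd _ _ _ hκt h
    rw [fourierSum_mixed h2 hφ hψ hψφ hcard hq1 ht hφt hκ hκK hεK Y O v (hY Y) hu0 hu hb',
      htb b' hb']
    have hsum : ∑ k : Fin 4, (O k : ℂ) * fourierSum ψ (octicFun κ ((k.val : ZMod 8) + κ b)) 1
        = (∑ k : Fin 4, O k * octicSign ((k.val : ZMod 8) + κ b) : ℤ) * B 0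
          + (∑ k : Fin 4, O k * octicOddSign ((k.val : ZMod 8) + κ b) : ℤ) * B 1 := by
      push_cast
      rw [Finset.sum_mul, Finset.sum_mul, ← Finset.sum_add_distrib]
      refine Finset.sum_congr rfl fun k _ => ?_
      have := eq_octicSign_mul_add hB4 hB3 ((k.val : ZMod 8) + κ b)
      simp only [hB] at this ⊢
      rw [this]
      ring
    rcases hs with ⟨rfl, rfl⟩ | ⟨rfl, rfl⟩
    · rw [hsum]
      push_cast
      ring
    · have hq4 : ∀ j : ZMod 8, quarticClass (2 - (j + 4)) = quarticClass (2 - j) := by decide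
      have hεneg : ε (t / -b) = ε (t / b) := by
        rw [div_neg, ← neg_one_mul]
        exact hεK _ _ (by simp) (div_ne_zero ht hb) (by simp)
      rw [hκneg b hb, hq4, hεneg]
      simp only [← add_assoc, fourierSum_octicFun_add_four, mul_neg, Finset.sum_neg_distrib, hsum]
      push_cast
      ring

lemma sum_sq_sub_sq (Q e x y : ℂ) (C Y a b : Fin 4 → ℂ) (he : e ^ 2 = 1)
    (hxy : x ^ 2 + 2 * y ^ 2 = -Q ^ 2) (hC : ∑ i, C i ^ 2 = 4) (hCY : ∑ i, C i * Y i = 0)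
    (hab : ∑ i, a i * b i = 0) (hb : ∑ i, b i ^ 2 = 2 * ∑ i, a i ^ 2)
    (hYa : ∑ i, Y i ^ 2 + ∑ i, a i ^ 2 = 8) :
    ∑ i, ((C i + Q * e * Y i) ^ 2 - (a i * x + b i * y) ^ 2) = 8 * Q ^ 2 + 4 := by
  simp only [Fin.sum_univ_four] at *
  linear_combination hC + 2 * Q * e * hCY - 2 * x * y * hab - y ^ 2 * hb + Q ^ 2 * hYa
    + Q ^ 2 * (Y 0 ^ 2 + Y 1 ^ 2 + Y 2 ^ 2 + Y 3 ^ 2) * he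
    - (a 0 ^ 2 + a 1 ^ 2 + a 2 ^ 2 + a 3 ^ 2) * hxy

/-- If tables of line parts `Y`, odd parts `O` and values `v` at zero satisfy a finite list of
quadratic relations, the Fourier transforms of the corresponding functions are complementary. -/
lemma sum_fourierSum_mul_neg_of_table {F : Type*} [Field F] [Fintype F] [DecidableEq F]
    {q : ℕ} {ψ : AddChar F ℂ} {u : Fin 4 → F → ℤ} {b : F} {x y : ℂ} {e : ℤ} {j : ZMod 8}
    (he : e = 1 ∨ e = -1) (hxy : x ^ 2 + 2 * y ^ 2 = -(q : ℂ) ^ 2)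
    (Y O : Fin 4 → Fin 4 → ℤ) (v : Fin 4 → ℤ)
    (hu : ∀ i, ∀ s : ℂ, ∀ b', (s = 1 ∧ b' = b) ∨ (s = -1 ∧ b' = -b) →
      2 * fourierSum ψ (fun z => (u i z : ℂ)) b'
        = ((2 * v i - ∑ k, Y i k : ℤ) + (q * e : ℂ) * Y i (quarticClass (2 - j)))
          + s * ((∑ k : Fin 4, O i k * octicSign ((k.val : ZMod 8) + j) : ℤ) * x
            + (∑ k : Fin 4, O i k * octicOddSign ((k.val : ZMod 8) + j) : ℤ) * y))
    (hC : ∑ i, (2 * v i - ∑ k, Y i k) ^ 2 = 4)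
    (hCY : ∀ m, ∑ i, (2 * v i - ∑ k, Y i k) * Y i m = 0)
    (hab : ∀ j : ZMod 8, ∑ i, (∑ k : Fin 4, O i k * octicSign ((k.val : ZMod 8) + j))
      * ∑ k : Fin 4, O i k * octicOddSign ((k.val : ZMod 8) + j) = 0)
    (hb : ∀ j : ZMod 8, ∑ i, (∑ k : Fin 4, O i k * octicOddSign ((k.val : ZMod 8) + j)) ^ 2
      = 2 * ∑ i, (∑ k : Fin 4, O i k * octicSign ((k.val : ZMod 8) + j)) ^ 2)
    (hYa : ∀ j : ZMod 8, ∑ i, Y i (quarticClass (2 - j)) ^ 2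
      + ∑ i, (∑ k : Fin 4, O i k * octicSign ((k.val : ZMod 8) + j)) ^ 2 = 8) :
    ∑ i, fourierSum ψ (fun z => (u i z : ℂ)) b * fourierSum ψ (fun z => (u i z : ℂ)) (-b)
      = 2 * (q : ℂ) ^ 2 + 1 := by
  have he2 : (e : ℂ) ^ 2 = 1 := by rcases he with rfl | rfl <;> simp
  have key := sum_sq_sub_sq (q : ℂ) e x y
    (fun i => ((2 * v i - ∑ k, Y i k : ℤ) : ℂ)) (fun i => (Y i (quarticClass (2 - j)) : ℂ))
    (fun i => ((∑ k : Fin 4, O i k * octicSign ((k.val : ZMod 8) + j) : ℤ) : ℂ))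
    (fun i => ((∑ k : Fin 4, O i k * octicOddSign ((k.val : ZMod 8) + j) : ℤ) : ℂ)) he2 hxy
    (by exact_mod_cast hC) (by exact_mod_cast hCY _) (by exact_mod_cast hab j)
    (by exact_mod_cast hb j) (by exact_mod_cast hYa j)
  refine mul_left_cancel₀ (show (4 : ℂ) ≠ 0 by norm_num) ?_
  rw [Finset.mul_sum, show (4 : ℂ) * (2 * (q : ℂ) ^ 2 + 1) = 8 * (q : ℂ) ^ 2 + 4 by ring, ← key]
  refine Finset.sum_congr rfl fun i _ => ?_
  have h1 := hu i 1 b (Or.inl ⟨rfl, rfl⟩)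
  have h2 := hu i (-1) (-b) (Or.inr ⟨rfl, rfl⟩)
  rw [show ∀ z w : ℂ, 4 * (z * w) = (2 * z) * (2 * w) by intros; ring, h1, h2]
  ring

/-- Coefficients of the line parts of the even components of the four blocks. -/
def lineU : Fin 4 → Fin 4 → ℤ := ![![2, 1, -2, -1], 0, ![-2, 1, 0, 1], ![0, 2, 0, -2]]

/-- Coefficients of the odd octic parts of the even components of the four blocks. -/
def oddU : Fin 4 → Fin 4 → ℤ := ![![0, 1, 0, 1], 0, ![0, 1, 0, 1], ![2, 0, 0, 0]]

/-- Values at zero of the even components of the four blocks. -/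
def zeroU : Fin 4 → ℤ := ![0, -1, 0, 0]

/-- Coefficients of the line parts of the odd components of the four blocks. -/
def lineV : Fin 4 → Fin 4 → ℤ := ![![0, -1, 0, -1], ![2, 2, -2, -2], ![0, -1, 2, 1], 0]

/-- Coefficients of the odd octic parts of the odd components of the four blocks. -/
def oddV : Fin 4 → Fin 4 → ℤ := ![![0, 1, 0, -1], 0, ![0, 1, 0, -1], ![0, 0, 2, 0]]

/-- Values at zero of the odd components of the four blocks. -/
def zeroV : Fin 4 → ℤ := ![-1, 0, 1, 1]

/-- The integer function with prescribed line part, odd octic part and value at zero. -/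
def mixedFun {F : Type*} [Zero F] [DecidableEq F] (κ : F → ZMod 8) (ε : F → ℤ)
    (Y O : Fin 4 → ℤ) (v : ℤ) (x : F) : ℤ :=
  if x = 0 then v
  else (ε x * Y (quarticClass (κ x)) + halfSign (κ x) * O (quarticClass (κ x))) / 2

lemma two_mul_mixedFun {F : Type*} [Zero F] [DecidableEq F] {κ : F → ZMod 8} {ε : F → ℤ}
    (hε : ∀ z, ε z = 1 ∨ ε z = -1) {Y O : Fin 4 → ℤ} (v : ℤ)
    (hYO : ∀ k, 2 ∣ Y k + O k) {x : F} (hx : x ≠ 0) :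
    2 * mixedFun κ ε Y O v x
      = ε x * Y (quarticClass (κ x)) + halfSign (κ x) * O (quarticClass (κ x)) := by
  rw [mixedFun, if_neg hx]
  refine Int.mul_ediv_cancel' ?_
  have hs : halfSign (κ x) = 1 ∨ halfSign (κ x) = -1 := by
    unfold halfSign; split_ifs <;> simp
  have h := hYO (quarticClass (κ x))
  rcases hε x with h1 | h1 <;> rcases hs with h2 | h2 <;> rw [h1, h2] <;> omega

lemma exists_complementary_functions {F : Type*} [Field F] [Fintype F] [DecidableEq F] {q : ℕ}
    (hF : Fintype.card F = q ^ 2) (hq : IsPrimePow q) (hq3 : q % 8 = 3) :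
    ∃ u v : Fin 4 → F → ℤ,
      (∀ i x, (u i x = 0 ∧ (v i x = 1 ∨ v i x = -1)) ∨
        (v i x = 0 ∧ (u i x = 1 ∨ u i x = -1))) ∧
      (∀ i, ∑ x, u i x = if i = 1 then -1 else 0) ∧
      (∀ g, ∑ i, autocorr (u i) g
        = (if g = 0 then 2 * (Fintype.card F : ℤ) + 1 else 0) - 2) ∧
      ∀ g, ∑ i, autocorr (v i) g = if g = 0 then 2 * (Fintype.card F : ℤ) + 1 else 0 := by
  obtain ⟨κ, ε, e, ψ, x, y, hprim, hε, he, hxy, hmix⟩ := exists_octicClass_fourierSum hF hq hq3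
  set u : Fin 4 → F → ℤ := fun i => mixedFun κ ε (lineU i) (oddU i) (zeroU i) with hu
  set v : Fin 4 → F → ℤ := fun i => mixedFun κ ε (lineV i) (oddV i) (zeroV i) with hv
  have hU : ∀ i, _ := fun i => hmix (lineU i) (oddU i) (zeroU i) (u i) (if_pos rfl)
    fun z hz => two_mul_mixedFun hε _ (by revert i; decide) hz
  have hV : ∀ i, _ := fun i => hmix (lineV i) (oddV i) (zeroV i) (v i) (if_pos rfl)
    fun z hz => two_mul_mixedFun hε _ (by revert i; decide) hz
  have hsumU : ∀ i, ∑ z, u i z = if i = 1 then -1 else 0 := by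
    intro i
    have h := (hU i).1
    have ht : ∀ i, ∑ k, lineU i k = 0 ∧ zeroU i = if i = 1 then -1 else 0 := by decide
    rw [(ht i).1, (ht i).2] at h
    omega
  have hsumV : ∑ i, (∑ z, v i z) ^ 2 = 2 * (q : ℤ) ^ 2 + 1 := by
    have ht : ∀ i, (∑ k, lineV i k = 2 * (![-1, 0, 1, 0] : Fin 4 → ℤ) i)
        ∧ zeroV i = (![-1, 0, 1, 1] : Fin 4 → ℤ) i := by decide
    have h : ∀ i, ∑ z, v i z = (![-1, 0, 1, 1] : Fin 4 → ℤ) i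
        + (q - 1) * (![-1, 0, 1, 0] : Fin 4 → ℤ) i := by
      intro i
      have h := (hV i).1
      rw [(ht i).1, (ht i).2] at h
      linarith
    simp only [h, Fin.sum_univ_four]
    simp
    ring
  refine ⟨u, v, ?_, hsumU, fun g => ?_, fun g => ?_⟩
  · intro i z
    by_cases hz : z = 0
    · have ht : ∀ i, (zeroU i = 0 ∧ (zeroV i = 1 ∨ zeroV i = -1)) ∨
        (zeroV i = 0 ∧ (zeroU i = 1 ∨ zeroU i = -1)) := by decide
      simpa [hu, hv, mixedFun, hz] using ht i
    · have ht : ∀ i, ∀ j : ZMod 8, ∀ s ∈ ({1, -1} : Finset ℤ),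
          ((s * lineU i (quarticClass j) + halfSign j * oddU i (quarticClass j)) / 2 = 0 ∧
            ((s * lineV i (quarticClass j) + halfSign j * oddV i (quarticClass j)) / 2 = 1 ∨
              (s * lineV i (quarticClass j) + halfSign j * oddV i (quarticClass j)) / 2 = -1)) ∨
          ((s * lineV i (quarticClass j) + halfSign j * oddV i (quarticClass j)) / 2 = 0 ∧
            ((s * lineU i (quarticClass j) + halfSign j * oddU i (quarticClass j)) / 2 = 1 ∨
              (s * lineU i (quarticClass j) + halfSign j * oddU i (quarticClass j)) / 2 = -1)) := by
        decide
      simpa only [hu, hv, mixedFun, hz, if_false] using ht i (κ z) (ε z) (by simpa using hε z)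
  · rw [sum_autocorr_eq_of_fourierSum hprim u (2 * Fintype.card F + 1) (-2) ?_ g]
    · ring
    intro b
    by_cases hb : b = 0
    · simp only [hb, neg_zero, fourierSum_zero_right, ← Int.cast_sum, hsumU, Fin.sum_univ_four]
      simp
    · rw [if_neg hb, hF, sum_fourierSum_mul_neg_of_table (he b) hxy lineU oddU zeroU
        (fun i => (hU i).2 b hb) (by decide) (by decide) (by decide) (by decide) (by decide)]
      push_cast
      ring
  · rw [sum_autocorr_eq_of_fourierSum hprim v (2 * Fintype.card F + 1) 0 ?_ g]
    · ring
    intro b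
    by_cases hb : b = 0
    · simp only [hb, neg_zero, fourierSum_zero_right, ← Int.cast_sum, ← sq]
      rw [hF]
      push_cast
      simpa using congrArg (Int.cast : ℤ → ℂ) hsumV
    · rw [if_neg hb, hF, sum_fourierSum_mul_neg_of_table (he b) hxy lineV oddV zeroV
        (fun i => (hV i).2 b hb) (by decide) (by decide) (by decide) (by decide) (by decide)]
      push_cast
      ring

end Combination

theorem stmt_0 (q : ℕ) (hq : IsPrimePow q) (c : ℤ)
    (hc : (q : ℤ) = 12 * c ^ 2 + 4 * c + 3)
    (F : Type*) [Field F] [Fintype F] (hF : Fintype.card F = q ^ 2) :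
    ∃ B₀ B₁ B₂ B₃ : Set (ZMod 2 × F),
      B₀.ncard = q ^ 2 ∧ B₁.ncard = q ^ 2 - 1 ∧ B₂.ncard = q ^ 2 ∧ B₃.ncard = q ^ 2 ∧
      ∀ g : ZMod 2 × F, g ≠ 0 →
        diffCount B₀ B₀ g + diffCount B₁ B₁ g + diffCount B₂ B₂ g + diffCount B₃ B₃ g
          = 2 * q ^ 2 - 2 := by
  classical
  have hq3 : q % 8 = 3 := by
    obtain ⟨d, hd⟩ : (2 : ℤ) ∣ c * (3 * c + 1) := by
      rcases Int.even_or_odd' c with ⟨k, rfl | rfl⟩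
      · exact ⟨k * (3 * (2 * k) + 1), by ring⟩
      · exact ⟨(2 * k + 1) * (3 * k + 2), by ring⟩
    have : (q : ℤ) = 8 * d + 3 := by linear_combination hc + 4 * hd
    omega
  obtain ⟨u, v, huv, hsum, hu, hv⟩ := exists_complementary_functions hF hq hq3
  simpa only [hF] using exists_differenceFamily_of_autocorr u v huv hsum hu hv
end

section
/- Let q be a prime power of the form q = 12c² + 4c + 3 for some integer c. Then there exists a Hadamard matrix of order 4(2q² + 1), i.e., a square integer matrix H of size 4(2q²+1) with all entries equal to 1 or −1 such that H · Hᵀ = 4(2q²+1) · I. -/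
open Finset Matrix

section GoethalsSeidel

variable {G : Type*} [AddCommGroup G] [Fintype G]

/-- The `(x, y)` block of the Goethals-Seidel array of four functions on an abelian group. -/
def goethalsSeidel (f : Fin 4 → G → ℤ) (x y : G) : Matrix (Fin 4) (Fin 4) ℤ :=
  !![f 0 (y - x), f 1 (-x - y), f 2 (-x - y), f 3 (-x - y);
     -f 1 (-x - y), f 0 (y - x), f 3 (x + y), -f 2 (x + y);
     -f 2 (-x - y), -f 3 (x + y), f 0 (y - x), f 1 (x + y);
     -f 3 (-x - y), f 2 (x + y), -f 1 (x + y), f 0 (y - x)]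

theorem sum_sub_mul_sub (a b : G → ℤ) (x x' : G) :
    ∑ y, a (y - x) * b (y - x') = ∑ u, a u * b (u + (x - x')) :=
  Fintype.sum_equiv (Equiv.subRight x) _ _ fun y => by
    simp only [Equiv.subRight_apply]; congr 2; abel

theorem sum_negSub_mul_negSub (a b : G → ℤ) (x x' : G) :
    ∑ y, a (-x - y) * b (-x' - y) = ∑ u, a u * b (u + (x - x')) :=
  Fintype.sum_equiv (Equiv.subLeft (-x)) _ _ fun y => by
    simp only [Equiv.subLeft_apply]; congr 2; abel

theorem sum_add_mul_add (a b : G → ℤ) (x x' : G) :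
    ∑ y, a (x + y) * b (x' + y) = ∑ u, b u * a (u + (x - x')) :=
  Fintype.sum_equiv (Equiv.addLeft x') _ _ fun y => by
    simp only [Equiv.coe_addLeft]; rw [mul_comm]; congr 2; abel

theorem sum_sub_mul_negSub (a b : G → ℤ) (x x' : G) :
    ∑ y, a (y - x) * b (-x' - y) = ∑ u, a u * b (-x - x' - u) :=
  Fintype.sum_equiv (Equiv.subRight x) _ _ fun y => by
    simp only [Equiv.subRight_apply]; congr 2; abel

theorem sum_negSub_mul_sub (a b : G → ℤ) (x x' : G) :
    ∑ y, b (-x - y) * a (y - x') = ∑ u, a u * b (-x - x' - u) :=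
  Fintype.sum_equiv (Equiv.subRight x') _ _ fun y => by
    simp only [Equiv.subRight_apply]; rw [mul_comm]; congr 2; abel

theorem sum_sub_mul_add (a b : G → ℤ) (x x' : G) :
    ∑ y, a (y - x) * b (x' + y) = ∑ u, a u * b (u + (x + x')) :=
  Fintype.sum_equiv (Equiv.subRight x) _ _ fun y => by
    simp only [Equiv.subRight_apply]; congr 2; abel

theorem sum_add_mul_sub (a b : G → ℤ) (x x' : G) :
    ∑ y, b (x + y) * a (y - x') = ∑ u, a u * b (u + (x + x')) :=
  Fintype.sum_equiv (Equiv.subRight x') _ _ fun y => by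
    simp only [Equiv.subRight_apply]; rw [mul_comm]; congr 2; abel

theorem sum_negSub_mul_add (a b : G → ℤ) (x x' : G) :
    ∑ y, a (-x - y) * b (x' + y) = ∑ u, a u * b (x' - x - u) :=
  Fintype.sum_equiv (Equiv.subLeft (-x)) _ _ fun y => by
    simp only [Equiv.subLeft_apply]; congr 2; abel

theorem sum_add_mul_negSub (a b : G → ℤ) (x x' : G) :
    ∑ y, a (x + y) * b (-x' - y) = ∑ u, a u * b (x - x' - u) :=
  Fintype.sum_equiv (Equiv.addLeft x) _ _ fun y => by
    simp only [Equiv.coe_addLeft]; congr 2; abel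

theorem sum_mul_sub_comm (a b : G → ℤ) (w : G) :
    ∑ u, a u * b (w - u) = ∑ u, b u * a (w - u) :=
  Fintype.sum_equiv (Equiv.subLeft w) _ _ fun y => by
    simp only [Equiv.subLeft_apply]; rw [mul_comm]; congr 2; abel

theorem sum_goethalsSeidel_mul_transpose (f : Fin 4 → G → ℤ) (x x' : G) :
    ∑ y, goethalsSeidel f x y * (goethalsSeidel f x' y)ᵀ =
      (∑ k, ∑ u, f k u * f k (u + (x - x'))) • (1 : Matrix (Fin 4) (Fin 4) ℤ) := by
  ext i j
  rw [Matrix.sum_apply]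
  simp only [Matrix.mul_apply, Matrix.transpose_apply, Fin.sum_univ_four, Matrix.smul_apply,
    smul_eq_mul]
  have h01 := sum_mul_sub_comm (f 0) (f 1)
  have h02 := sum_mul_sub_comm (f 0) (f 2)
  have h03 := sum_mul_sub_comm (f 0) (f 3)
  have h12 := sum_mul_sub_comm (f 1) (f 2)
  have h13 := sum_mul_sub_comm (f 1) (f 3)
  have h23 := sum_mul_sub_comm (f 2) (f 3)
  fin_cases i <;> fin_cases j <;>
    simp [goethalsSeidel, sum_add_distrib, sum_sub_mul_sub, sum_negSub_mul_negSub, sum_add_mul_add,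
      sum_sub_mul_negSub, sum_negSub_mul_sub, sum_sub_mul_add, sum_add_mul_sub, sum_negSub_mul_add,
      sum_add_mul_negSub] <;>
    first
    | ring1
    | linarith [h01 (-x - x'), h02 (-x - x'), h03 (-x - x'), h12 (x - x'), h12 (x' - x),
        h13 (x - x'), h13 (x' - x), h23 (x - x'), h23 (x' - x)]

theorem sum_goethalsSeidel (f : Fin 4 → G → ℤ) (x : G) (h0 : ∑ u, f 0 u = 2)
    (h : ∀ k, k ≠ 0 → ∑ u, f k u = 0) : ∑ y, goethalsSeidel f x y = (2 : ℤ) • 1 := by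
  have hs (k : Fin 4) : ∑ y, f k (y - x) = ∑ u, f k u := Equiv.sum_comp (Equiv.subRight x) _
  have hn (k : Fin 4) : ∑ y, f k (-x - y) = ∑ u, f k u := Equiv.sum_comp (Equiv.subLeft (-x)) _
  have ha (k : Fin 4) : ∑ y, f k (x + y) = ∑ u, f k u := Equiv.sum_comp (Equiv.addLeft x) _
  ext i j
  rw [Matrix.sum_apply]
  fin_cases i <;> fin_cases j <;>
    simp [goethalsSeidel, hs, hn, ha, h0, h]

/-- A bordered Goethals-Seidel array. -/
def borderedGoethalsSeidel (f : Fin 4 → G → ℤ) :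
    Matrix (Fin 4 ⊕ G × Fin 4) (Fin 4 ⊕ G × Fin 4) ℤ :=
  Matrix.fromBlocks
    !![1, 1, 1, 1; -1, 1, -1, 1; -1, -1, 1, 1; -1, 1, 1, -1]
    (Matrix.of fun i p => !![1, 1, 1, 1; 1, -1, 1, -1; 1, 1, -1, -1; 1, -1, -1, 1] i p.2)
    (Matrix.of fun p j => !![1, -1, -1, -1; -1, 1, -1, -1; -1, -1, 1, -1; -1, -1, -1, 1] p.2 j)
    (Matrix.of fun p r => goethalsSeidel f p.1 r.1 p.2 r.2)

omit [Fintype G] in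
theorem borderedGoethalsSeidel_entry (f : Fin 4 → G → ℤ) (hf : ∀ k x, f k x = 1 ∨ f k x = -1)
    (a b : Fin 4 ⊕ G × Fin 4) :
    borderedGoethalsSeidel f a b = 1 ∨ borderedGoethalsSeidel f a b = -1 := by
  have hn (k x) : f k x = -1 ∨ f k x = 1 := (hf k x).symm
  have hm (k x) : -f k x = 1 ∨ f k x = 1 := by rcases hf k x with h | h <;> simp [h]
  rcases a with i | ⟨x, i⟩ <;> rcases b with j | ⟨y, j⟩
  · fin_cases i <;> fin_cases j <;> simp [borderedGoethalsSeidel]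
  · fin_cases i <;> fin_cases j <;> simp [borderedGoethalsSeidel]
  · fin_cases i <;> fin_cases j <;> simp [borderedGoethalsSeidel]
  · fin_cases i <;> fin_cases j <;> simp [borderedGoethalsSeidel, goethalsSeidel, hf, hm]

theorem borderedGoethalsSeidel_mul_transpose [DecidableEq G] (f : Fin 4 → G → ℤ)
    (h0 : ∑ u, f 0 u = 2) (h : ∀ k, k ≠ 0 → ∑ u, f k u = 0)
    (hf : ∀ z, ∑ k, ∑ u, f k u * f k (u + z) = if z = 0 then 4 * (Fintype.card G : ℤ) else -4) :
    borderedGoethalsSeidel f * (borderedGoethalsSeidel f)ᵀ =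
      (4 * (Fintype.card G + 1) : ℤ) • 1 := by
  have hrow (x : G) (i j : Fin 4) :
      ∑ y, goethalsSeidel f x y i j = ((2 : ℤ) • (1 : Matrix (Fin 4) (Fin 4) ℤ)) i j := by
    rw [← sum_goethalsSeidel f x h0 h, Matrix.sum_apply]
  have hgram (x x' : G) (i j : Fin 4) :
      ∑ y, ∑ k, goethalsSeidel f x y i k * goethalsSeidel f x' y j k =
        ((if x = x' then 4 * (Fintype.card G : ℤ) else -4) •
          (1 : Matrix (Fin 4) (Fin 4) ℤ)) i j := by
    have := congrFun (congrFun (sum_goethalsSeidel_mul_transpose f x x') i) j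
    rw [hf, Matrix.sum_apply] at this
    simpa [Matrix.mul_apply, sub_eq_zero] using this
  rw [borderedGoethalsSeidel, Matrix.fromBlocks_transpose, Matrix.fromBlocks_multiply,
    ← Matrix.fromBlocks_one, Matrix.fromBlocks_smul]
  congr 1
  · ext i j
    simp only [Matrix.add_apply, Matrix.mul_apply, Fintype.sum_prod_type]
    fin_cases i <;> fin_cases j <;> simp [Fin.sum_univ_four] <;> ring
  · ext i ⟨x, j⟩
    simp only [Matrix.add_apply, Matrix.mul_apply, Fintype.sum_prod_type]
    rw [sum_comm (s := univ) (t := univ)]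
    simp only [Matrix.transpose_apply, Matrix.of_apply, ← mul_sum, hrow]
    fin_cases i <;> fin_cases j <;> simp [Fin.sum_univ_four, Matrix.one_apply]
  · ext ⟨x, i⟩ j
    simp only [Matrix.add_apply, Matrix.mul_apply, Fintype.sum_prod_type]
    rw [sum_comm (s := univ) (t := univ)]
    simp only [Matrix.transpose_apply, Matrix.of_apply, ← sum_mul, hrow]
    fin_cases i <;> fin_cases j <;> simp [Fin.sum_univ_four, Matrix.one_apply]
  · ext ⟨x, i⟩ ⟨x', j⟩
    simp only [Matrix.add_apply, Matrix.mul_apply, Fintype.sum_prod_type, Matrix.transpose_apply,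
      Matrix.of_apply, hgram]
    by_cases hx : x = x'
    · subst hx
      fin_cases i <;> fin_cases j <;> simp [Fin.sum_univ_four] <;> ring
    · fin_cases i <;> fin_cases j <;> simp [Fin.sum_univ_four, hx]

theorem exists_hadamard_of_autocorrelation [DecidableEq G] (f : Fin 4 → G → ℤ) (n : ℕ)
    (hn : n = 4 * (Fintype.card G + 1)) (hf1 : ∀ k x, f k x = 1 ∨ f k x = -1)
    (h0 : ∑ u, f 0 u = 2) (h : ∀ k, k ≠ 0 → ∑ u, f k u = 0)
    (hf : ∀ z, ∑ k, ∑ u, f k u * f k (u + z) = if z = 0 then 4 * (Fintype.card G : ℤ) else -4) :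
    ∃ H : Matrix (Fin n) (Fin n) ℤ, (∀ i j, H i j = 1 ∨ H i j = -1) ∧
      H * H.transpose = (n : ℤ) • 1 := by
  have hn' : (n : ℤ) = 4 * (Fintype.card G + 1) := by rw [hn]; push_cast; ring
  have hcard : Fintype.card (Fin 4 ⊕ G × Fin 4) = n := by
    simp [hn]; ring
  let e := Fintype.equivFinOfCardEq hcard
  refine ⟨Matrix.reindex e e (borderedGoethalsSeidel f), fun i j => ?_, ?_⟩
  · exact borderedGoethalsSeidel_entry f hf1 _ _
  · rw [Matrix.transpose_reindex, Matrix.reindex_apply, Matrix.reindex_apply,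
      Matrix.submatrix_mul_equiv, borderedGoethalsSeidel_mul_transpose f h0 h hf, hn']
    exact congrArg (fun M : Matrix (Fin n) (Fin n) ℤ => (4 * (Fintype.card G + 1) : ℤ) • M)
      (Matrix.submatrix_one_equiv e.symm)

theorem exists_hadamard_of_pairs [DecidableEq G] (a b : Fin 4 → G → ℤ) (n : ℕ)
    (hn : n = 4 * (2 * Fintype.card G + 1)) (ha : ∀ k x, a k x = 1 ∨ a k x = -1)
    (hb : ∀ k x, b k x = 1 ∨ b k x = -1) (h0 : ∑ u, (a 0 u + b 0 u) = 2)
    (h : ∀ k, k ≠ 0 → ∑ u, (a k u + b k u) = 0)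
    (hadd : ∀ z, ∑ k, ∑ u, (a k u + b k u) * (a k (u + z) + b k (u + z)) =
      if z = 0 then 8 * (Fintype.card G : ℤ) - 4 else -8)
    (hsub : ∀ z, ∑ k, ∑ u, (a k u - b k u) * (a k (u + z) - b k (u + z)) =
      if z = 0 then 8 * (Fintype.card G : ℤ) + 4 else 0) :
    ∃ H : Matrix (Fin n) (Fin n) ℤ, (∀ i j, H i j = 1 ∨ H i j = -1) ∧
      H * H.transpose = (n : ℤ) • 1 := by
  have hcard : Fintype.card (G × ZMod 2) = 2 * Fintype.card G := by
    rw [Fintype.card_prod, ZMod.card, mul_comm]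
  refine exists_hadamard_of_autocorrelation (G := G × ZMod 2)
    (fun k p => if p.2 = 0 then a k p.1 else b k p.1) n (by rw [hcard, hn]) ?_ ?_ ?_ ?_
  · intro k x
    split_ifs
    exacts [ha k _, hb k _]
  · rw [Fintype.sum_prod_type, ← h0]
    exact sum_congr rfl fun u _ => Fin.sum_univ_two _
  · intro k hk
    rw [Fintype.sum_prod_type, ← h k hk]
    exact sum_congr rfl fun u _ => Fin.sum_univ_two _
  · rintro ⟨z, w⟩
    have hz := hadd z
    have hz' := hsub z
    simp only [add_mul, mul_add, sub_mul, mul_sub, sum_add_distrib, sum_sub_distrib] at hz hz'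
    rw [hcard]
    simp only [Fintype.sum_prod_type, Prod.mk_add_mk, Prod.mk_eq_zero]
    have hz2 (s : ZMod 2 → ℤ) : ∑ i, s i = s 0 + s 1 := Fin.sum_univ_two _
    have hw : w = 0 ∨ w = 1 := by revert w; decide
    rcases hw with rfl | rfl
    · simp only [hz2, add_zero, and_true, if_true, one_ne_zero, if_false,
        sum_add_distrib]
      split_ifs at hz hz' ⊢ <;> push_cast <;> linarith
    · simp only [hz2, show (1 + 1 : ZMod 2) = 0 from rfl, zero_add, and_false, if_true,
        one_ne_zero, if_false, sum_add_distrib, mul_comm (b _ _) (a _ (_ + _))] at hz hz' ⊢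
      split_ifs at hz hz' ⊢ <;> linarith

end GoethalsSeidel

section DiscreteLog

variable {F : Type*} [Field F] [Fintype F]

/-- The least exponent `n` with `γ ^ n = x`. -/
noncomputable def dlog (γ x : F) : ℕ := sInf {n | γ ^ n = x}

theorem exists_pow_eq_of_orderOf {γ : F} (hγ : orderOf γ = Fintype.card F - 1) {x : F}
    (hx : x ≠ 0) : ∃ n, γ ^ n = x := by
  classical
  have h0 : γ ≠ 0 := by
    rintro rfl
    have := Fintype.one_lt_card (α := F)
    rw [orderOf_zero F] at hγ
    omega
  have hu : orderOf (Units.mk0 γ h0) = Nat.card Fˣ := by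
    rw [← orderOf_units, Units.val_mk0, hγ, Nat.card_eq_fintype_card, Fintype.card_units]
  have htop : Subgroup.zpowers (Units.mk0 γ h0) = ⊤ :=
    Subgroup.eq_top_of_card_eq _ (by rw [Nat.card_zpowers, hu])
  obtain ⟨n, hn⟩ := mem_powers_iff_mem_zpowers.2 (htop ▸ Subgroup.mem_top (Units.mk0 x hx))
  exact ⟨n, by simpa using congrArg Units.val hn⟩

theorem pow_dlog {γ : F} (hγ : orderOf γ = Fintype.card F - 1) {x : F} (hx : x ≠ 0) :
    γ ^ dlog γ x = x :=
  Nat.sInf_mem (s := {n | γ ^ n = x}) (exists_pow_eq_of_orderOf hγ hx)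

theorem sum_eq_add_sum_pow {M : Type*} [AddCommMonoid M] {γ : F}
    (hγ : orderOf γ = Fintype.card F - 1) (f : F → M) :
    ∑ x, f x = f 0 + ∑ n ∈ range (Fintype.card F - 1), f (γ ^ n) := by
  classical
  have h0 : γ ≠ 0 := by
    rintro rfl
    have := Fintype.one_lt_card (α := F)
    rw [orderOf_zero F] at hγ
    omega
  rw [← add_sum_erase _ _ (mem_univ 0)]
  congr 1
  symm
  refine sum_nbij (γ ^ ·) (fun n _ => by simp [h0]) ?_ ?_ fun _ _ => rfl
  · rw [← hγ, coe_range]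
    exact pow_injOn_Iio_orderOf
  · intro x hx
    obtain ⟨n, hn⟩ := exists_pow_eq_of_orderOf hγ (by simpa using hx)
    have := Fintype.one_lt_card (α := F)
    exact ⟨n % orderOf γ, by simpa [hγ] using Nat.mod_lt _ (by omega),
      by simp [pow_mod_orderOf, hn]⟩

end DiscreteLog

/-- `γ` generates the multiplicative group of a quadratic extension `F` of a field `K` with
`q ≡ 3 [MOD 8]` elements. -/
structure IsQuadraticGenerator (K : Type*) {F : Type*} [Field K] [Field F] [Fintype K] [Fintype F]
    [Algebra K F] (q : ℕ) (γ : F) : Prop where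
  card_base : Fintype.card K = q
  finrank : Module.finrank K F = 2
  mod_eight : q % 8 = 3
  orderOf_eq : orderOf γ = Fintype.card F - 1

/-- The discrete logarithm modulo `8`. -/
noncomputable def octicClass {F : Type*} [Field F] (γ x : F) : ZMod 8 := dlog γ x

/-- The sign with value `(-1) ^ ⌊j / 4⌋` at `γ ^ n`, where `0 ≤ j < r` and `j ≡ n [MOD r]`. -/
noncomputable def blockSign {F : Type*} [Field F] (r : ℕ) (γ x : F) : ℤ :=
  (-1) ^ (dlog γ x % r / 4)

section QuadraticGenerator

namespace IsQuadraticGenerator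

variable {K F : Type*} [Field K] [Field F] [Fintype K] [Fintype F] [Algebra K F] {q : ℕ} {γ : F}

theorem card_eq (h : IsQuadraticGenerator K q γ) : Fintype.card F = q ^ 2 := by
  rw [← h.card_base, ← h.finrank, Module.card_eq_pow_finrank (K := K) (V := F)]

theorem card_sub_one (h : IsQuadraticGenerator K q γ) :
    Fintype.card F - 1 = (q - 1) * (q + 1) := by
  rw [h.card_eq, mul_comm, ← Nat.sq_sub_sq, one_pow]

theorem exists_eq (h : IsQuadraticGenerator K q γ) : ∃ t, q = 8 * t + 3 :=
  ⟨q / 8, by have := h.mod_eight; omega⟩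

theorem eight_dvd (h : IsQuadraticGenerator K q γ) : 8 ∣ Fintype.card F - 1 := by
  obtain ⟨t, rfl⟩ := h.exists_eq
  rw [h.card_sub_one]
  exact ⟨(4 * t + 1) * (2 * t + 1), by simp only [Nat.add_one_sub_one]; ring⟩

theorem ne_zero (h : IsQuadraticGenerator K q γ) : γ ≠ 0 := by
  have h1 := h.orderOf_eq
  have := Fintype.one_lt_card (α := F)
  rintro rfl
  rw [orderOf_zero F] at h1
  omega

theorem exists_pow (h : IsQuadraticGenerator K q γ) {x : F} (hx : x ≠ 0) : ∃ n, γ ^ n = x :=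
  exists_pow_eq_of_orderOf h.orderOf_eq hx

theorem dlog_pow (h : IsQuadraticGenerator K q γ) (n : ℕ) :
    dlog γ (γ ^ n) ≡ n [MOD Fintype.card F - 1] := by
  rw [← h.orderOf_eq, ← Units.val_mk0 h.ne_zero, orderOf_units, ← pow_eq_pow_iff_modEq,
    Units.ext_iff]
  simpa using pow_dlog h.orderOf_eq (pow_ne_zero n h.ne_zero)

theorem octicClass_pow (h : IsQuadraticGenerator K q γ) (n : ℕ) : octicClass γ (γ ^ n) = n :=
  (ZMod.natCast_eq_natCast_iff _ _ _).2 ((h.dlog_pow n).of_dvd h.eight_dvd)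

theorem blockSign_pow (h : IsQuadraticGenerator K q γ) (n : ℕ) :
    blockSign (q + 1) γ (γ ^ n) = (-1) ^ (n % (q + 1) / 4) := by
  rw [blockSign, (h.dlog_pow n).of_dvd (h.card_sub_one ▸ dvd_mul_left _ _)]

theorem octicClass_mul (h : IsQuadraticGenerator K q γ) {x y : F} (hx : x ≠ 0) (hy : y ≠ 0) :
    octicClass γ (x * y) = octicClass γ x + octicClass γ y := by
  obtain ⟨m, rfl⟩ := h.exists_pow hx
  obtain ⟨n, rfl⟩ := h.exists_pow hy
  simp [← pow_add, h.octicClass_pow]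

theorem octicClass_div (h : IsQuadraticGenerator K q γ) {x y : F} (hx : x ≠ 0) (hy : y ≠ 0) :
    octicClass γ (x / y) = octicClass γ x - octicClass γ y := by
  rw [eq_sub_iff_add_eq, ← h.octicClass_mul (div_ne_zero hx hy) hy, div_mul_cancel₀ x hy]

theorem octicClass_frobenius (h : IsQuadraticGenerator K q γ) {x : F} (hx : x ≠ 0) :
    octicClass γ (x ^ q) = 3 * octicClass γ x := by
  obtain ⟨m, rfl⟩ := h.exists_pow hx
  obtain ⟨t, rfl⟩ := h.exists_eq
  rw [← pow_mul, h.octicClass_pow, h.octicClass_pow]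
  have : (8 : ZMod 8) = 0 := rfl
  push_cast
  linear_combination (m * t) * this

theorem exists_pow_algebraMap (h : IsQuadraticGenerator K q γ) {k : K} (hk : k ≠ 0) :
    ∃ n, γ ^ ((q + 1) * n) = algebraMap K F k := by
  obtain ⟨m, hm⟩ := h.exists_pow (x := algebraMap K F k) (by simpa using hk)
  have h1 : γ ^ (m * (q - 1)) = 1 := by
    rw [pow_mul, hm, ← map_pow, ← h.card_base, FiniteField.pow_card_sub_one_eq_one k hk, map_one]
  have h2 := orderOf_dvd_of_pow_eq_one h1
  have h3 := h.mod_eight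
  rw [h.orderOf_eq, h.card_sub_one, mul_comm m, Nat.mul_dvd_mul_iff_left (by omega)] at h2
  obtain ⟨n, rfl⟩ := h2
  exact ⟨n, hm⟩

theorem blockSign_algebraMap_mul (h : IsQuadraticGenerator K q γ) {k : K} (hk : k ≠ 0) {x : F}
    (hx : x ≠ 0) : blockSign (q + 1) γ (algebraMap K F k * x) = blockSign (q + 1) γ x := by
  obtain ⟨m, rfl⟩ := h.exists_pow hx
  obtain ⟨n, hn⟩ := h.exists_pow_algebraMap hk
  rw [← hn, ← pow_add, h.blockSign_pow, h.blockSign_pow, Nat.mul_add_mod]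

theorem octicClass_algebraMap (h : IsQuadraticGenerator K q γ) {k : K} (hk : k ≠ 0) :
    octicClass γ (algebraMap K F k) = 0 ∨ octicClass γ (algebraMap K F k) = 4 := by
  obtain ⟨n, hn⟩ := h.exists_pow_algebraMap hk
  obtain ⟨t, rfl⟩ := h.exists_eq
  rw [← hn, h.octicClass_pow]
  have : ((8 * t + 3 + 1) * n : ℕ) = 4 * (((2 * t + 1) * n : ℕ) : ZMod 8) := by push_cast; ring
  rw [this]
  generalize (((2 * t + 1) * n : ℕ) : ZMod 8) = z
  revert z
  decide

theorem octicClass_neg_one (h : IsQuadraticGenerator K q γ) : octicClass γ (-1 : F) = 4 := by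
  have hcard := h.card_sub_one
  obtain ⟨t, rfl⟩ := h.exists_eq
  have hN : Fintype.card F - 1 = 2 * (4 * ((4 * t + 1) * (2 * t + 1))) := by
    rw [hcard, Nat.add_one_sub_one]; ring
  have hpow : γ ^ (4 * ((4 * t + 1) * (2 * t + 1))) = -1 := by
    have h1 : (γ ^ (4 * ((4 * t + 1) * (2 * t + 1)))) ^ 2 = 1 := by
      rw [← pow_mul, mul_comm _ 2, ← hN, ← h.orderOf_eq, pow_orderOf_eq_one]
    refine (mul_self_eq_one_iff.1 (by rwa [← sq])).resolve_left ?_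
    intro h2
    have h3 := Nat.le_of_dvd (by positivity) (orderOf_dvd_of_pow_eq_one h2)
    rw [h.orderOf_eq, hN] at h3
    have : 0 < 4 * ((4 * t + 1) * (2 * t + 1)) := by positivity
    omega
  rw [← hpow, h.octicClass_pow]
  have : (8 : ZMod 8) = 0 := rfl
  push_cast
  linear_combination (4 * t ^ 2 + 3 * t) * this

theorem octicClass_neg (h : IsQuadraticGenerator K q γ) {x : F} (hx : x ≠ 0) :
    octicClass γ (-x) = octicClass γ x + 4 := by
  rw [← neg_one_mul, h.octicClass_mul (by simp) hx, h.octicClass_neg_one, add_comm]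

theorem blockSign_neg (h : IsQuadraticGenerator K q γ) {x : F} (hx : x ≠ 0) :
    blockSign (q + 1) γ (-x) = blockSign (q + 1) γ x := by
  simpa using h.blockSign_algebraMap_mul (k := -1) (by simp) hx

theorem sum_ite_octicClass [DecidableEq F] (h : IsQuadraticGenerator K q γ) (φ : ZMod 8 → ℂ) :
    8 * ∑ x : F, (if x = 0 then 0 else φ (octicClass γ x)) = (q ^ 2 - 1) * ∑ j, φ j := by
  have hr (s : ℕ) : ∑ n ∈ range (8 * s), φ n = s * ∑ j, φ j := by
    have h8 (f : ZMod 8 → ℂ) : ∑ j, f j = ∑ i ∈ range 8, f i := by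
      rw [← Fin.sum_univ_eq_sum_range (fun i => f i)]
      exact Fintype.sum_congr _ _ fun i => congrArg f (ZMod.natCast_zmod_val (n := 8) i).symm
    induction s with
    | zero => simp
    | succ s ih =>
      rw [Nat.mul_succ, sum_range_add, ih, h8]
      have : (8 : ZMod 8) = 0 := rfl
      simp [this]
      ring
  obtain ⟨s, hs⟩ := h.eight_dvd
  have hs' : (q : ℂ) ^ 2 - 1 = 8 * s := by
    have h1 := h.card_eq
    have h2 := Fintype.one_lt_card (α := F)
    have h3 : q ^ 2 = 8 * s + 1 := by omega
    have h4 : (q : ℂ) ^ 2 = 8 * s + 1 := by exact_mod_cast h3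
    rw [h4]; ring
  rw [sum_eq_add_sum_pow h.orderOf_eq, hs, hs', mul_assoc, ← hr]
  simp [h.ne_zero, h.octicClass_pow]

theorem sum_ite_blockSign [DecidableEq F] (h : IsQuadraticGenerator K q γ) (c : ZMod 8 → ℂ)
    (hc : ∀ j, c (j + 4) = c j) :
    ∑ x : F, (if x = 0 then 0 else c (octicClass γ x) * blockSign (q + 1) γ x) =
      (q - 1) * (c 0 + c 1 + c 2 + c 3) := by
  have hcard := h.card_sub_one
  have h4 (b : ℕ) (i : ℕ) : c ((4 * b + i : ℕ) : ZMod 8) = c i := by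
    induction b with
    | zero => simp
    | succ b ih => rw [← ih, ← hc ((4 * b + i : ℕ) : ZMod 8)]; push_cast; congr 1; ring
  have hb (s : ℕ) : ∑ n ∈ range (4 * s), c n * (-1) ^ (n / 4) =
      (if Even s then 0 else 1) * (c 0 + c 1 + c 2 + c 3) := by
    induction s with
    | zero => simp
    | succ s ih =>
      rw [Nat.mul_succ, sum_range_add, ih]
      simp only [h4, Nat.mul_add_div (show 4 > 0 by norm_num), sum_range_succ, range_zero,
        sum_empty, Nat.even_add_one]
      by_cases hs : Even s
      · simp [hs]
      · simp [hs, (Nat.not_even_iff_odd.1 hs).neg_one_pow]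
        ring
  have hr (r k : ℕ) : ∑ n ∈ range (k * (4 * r)), c n * (-1) ^ (n % (4 * r) / 4) =
      k * ∑ n ∈ range (4 * r), c n * (-1) ^ (n / 4) := by
    induction k with
    | zero => simp
    | succ k ih =>
      rw [Nat.succ_mul, sum_range_add, ih, Nat.cast_succ, add_one_mul]
      congr 1
      refine sum_congr rfl fun i hi => ?_
      rw [Nat.mul_add_mod_of_lt (mem_range.1 hi),
        show k * (4 * r) + i = 4 * (k * r) + i by ring, h4]
  obtain ⟨t, rfl⟩ := h.exists_eq
  rw [sum_eq_add_sum_pow h.orderOf_eq, hcard]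
  simp only [h.ne_zero, pow_eq_zero_iff', false_and, if_false, if_true, h.octicClass_pow,
    h.blockSign_pow, zero_add, Int.cast_pow, Int.cast_neg, Int.cast_one]
  rw [show 8 * t + 3 + 1 = 4 * (2 * t + 1) by ring, hr, hb]
  have hodd : ¬Even (2 * t + 1) := by simp
  rw [if_neg hodd]
  push_cast
  ring

end IsQuadraticGenerator

end QuadraticGenerator

section TraceFourier

variable {K F : Type*} [Field K] [Field F] [Algebra K F] [Fintype F]

/-- The Fourier transform on `F` with respect to the additive character `ψ ∘ Tr`. -/
noncomputable def traceFourier (ψ : AddChar K ℂ) (f : F → ℂ) (y : F) : ℂ :=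
  ∑ x, f x * ψ (Algebra.trace K F (x * y))

theorem traceFourier_zero_right (ψ : AddChar K ℂ) (f : F → ℂ) :
    traceFourier ψ f 0 = ∑ x, f x := by
  simp [traceFourier]

theorem traceFourier_add (ψ : AddChar K ℂ) (f g : F → ℂ) (y : F) :
    traceFourier ψ (fun x => f x + g x) y = traceFourier ψ f y + traceFourier ψ g y := by
  simp [traceFourier, add_mul, sum_add_distrib]

theorem traceFourier_ite_zero [DecidableEq F] (ψ : AddChar K ℂ) (r : ℂ) (y : F) :
    traceFourier ψ (fun x => if x = 0 then r else 0) y = r := by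
  simp [traceFourier, ite_mul]

variable [Fintype K]

theorem trace_surjective_of_finite : Function.Surjective (Algebra.trace K F) :=
  have : Algebra.IsSeparable K F := inferInstance
  Algebra.trace_surjective K F

theorem sum_addChar_trace_mul [DecidableEq F] {ψ : AddChar K ℂ} (hψ : ψ ≠ 1) (z : F) :
    ∑ y : F, ψ (Algebra.trace K F (y * z)) = if z = 0 then (Fintype.card F : ℂ) else 0 := by
  set ψ' : AddChar F ℂ := ψ.compAddMonoidHom (Algebra.trace K F).toAddMonoidHom with hdef
  have hψ' : ψ' ≠ 1 := by
    obtain ⟨a, ha⟩ := AddChar.ne_one_iff.1 hψ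
    obtain ⟨b, rfl⟩ := trace_surjective_of_finite (F := F) a
    exact AddChar.ne_one_iff.2 ⟨b, ha⟩
  simpa [hdef] using AddChar.sum_mulShift z (AddChar.IsPrimitive.of_ne_one hψ')

theorem sum_traceFourier_mul [DecidableEq F] {ψ : AddChar K ℂ} (hψ : ψ ≠ 1) (f : F → ℂ) (z : F) :
    ∑ y, traceFourier ψ f y * traceFourier ψ f (-y) * ψ (Algebra.trace K F (y * z)) =
      Fintype.card F * ∑ x, f x * f (x + z) := by
  calc
    _ = ∑ y, ∑ a, ∑ b, f a * f b * ψ (Algebra.trace K F (y * (a + z - b))) := by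
      refine sum_congr rfl fun y _ => ?_
      rw [traceFourier, traceFourier, sum_mul_sum, sum_mul]
      refine sum_congr rfl fun a _ => ?_
      rw [sum_mul]
      refine sum_congr rfl fun b _ => ?_
      rw [show y * (a + z - b) = a * y + b * -y + y * z by ring, map_add (Algebra.trace K F),
        map_add (Algebra.trace K F), AddChar.map_add_eq_mul, AddChar.map_add_eq_mul]
      ring
    _ = ∑ a, ∑ b, f a * f b * (if b = a + z then (Fintype.card F : ℂ) else 0) := by
      rw [sum_comm]
      refine sum_congr rfl fun a _ => ?_
      rw [sum_comm]
      refine sum_congr rfl fun b _ => ?_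
      rw [← mul_sum, sum_addChar_trace_mul hψ]
      simp only [sub_eq_zero, eq_comm]
    _ = _ := by
      simp [mul_sum, mul_comm]

/-- A family of functions whose power spectra add up to a constant off the origin has constant
autocorrelation off the origin. -/
theorem sum_autocorrelation_of_traceFourier [DecidableEq F] {ι : Type*} [Fintype ι]
    {ψ : AddChar K ℂ} (hψ : ψ ≠ 1) (f : ι → F → ℤ) (α β : ℂ)
    (hf : ∀ y, ∑ k, traceFourier ψ (fun x => (f k x : ℂ)) y *
      traceFourier ψ (fun x => (f k x : ℂ)) (-y) = α + if y = 0 then β else 0) (z : F) :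
    (Fintype.card F : ℂ) * ((∑ k, ∑ x, f k x * f k (x + z) : ℤ) : ℂ) =
      (if z = 0 then α * Fintype.card F else 0) + β := by
  push_cast
  simp only [mul_sum (s := (univ : Finset ι)), ← sum_traceFourier_mul hψ]
  rw [sum_comm]
  simp only [← sum_mul, hf, add_mul, sum_add_distrib, ← mul_sum, sum_addChar_trace_mul hψ]
  simp

omit [Fintype K] in
theorem traceFourier_eq_sum_algebraMap_mul (ψ : AddChar K ℂ) (f : F → ℂ) {k : K} (hk : k ≠ 0)
    (y : F) :
    traceFourier ψ f y = ∑ x, f (algebraMap K F k * x) * ψ (k * Algebra.trace K F (x * y)) := by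
  symm
  refine Fintype.sum_equiv (Equiv.mulLeft₀ (algebraMap K F k) (by simpa using hk)) _ _ fun x => ?_
  change _ = f (algebraMap K F k * x) * ψ (Algebra.trace K F (algebraMap K F k * x * y))
  rw [mul_assoc (algebraMap K F k), ← Algebra.smul_def (A := F) k (x * y), map_smul, smul_eq_mul]

theorem finrank_ker_trace (hF : Module.finrank K F = 2) :
    Module.finrank K (LinearMap.ker (Algebra.trace K F)) = 1 := by
  have h := LinearMap.finrank_range_add_finrank_ker (Algebra.trace K F)
  rw [LinearMap.range_eq_top.2 trace_surjective_of_finite, finrank_top, Module.finrank_self,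
    hF] at h
  omega

theorem exists_algebraMap_mul_eq_of_trace_eq_zero (hF : Module.finrank K F = 2) {δ : F}
    (hδ : δ ≠ 0) (htr : Algebra.trace K F δ = 0) {x : F} (hx : Algebra.trace K F x = 0) :
    ∃ k : K, algebraMap K F k * δ = x := by
  obtain ⟨k, hk⟩ := (finrank_eq_one_iff_of_nonzero' (⟨δ, htr⟩ : LinearMap.ker (Algebra.trace K F))
    (by simpa [Subtype.ext_iff] using hδ)).1 (finrank_ker_trace hF) ⟨x, hx⟩
  exact ⟨k, by simpa [Algebra.smul_def] using congrArg Subtype.val hk⟩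

variable [DecidableEq K]

theorem sum_ite_trace_eq_zero (hF : Module.finrank K F = 2) {e : F → ℂ} (h0 : e 0 = 0)
    (he : ∀ k : K, k ≠ 0 → ∀ x, e (algebraMap K F k * x) = e x) {δ : F} (hδ : δ ≠ 0)
    (htr : Algebra.trace K F δ = 0) {y : F} (hy : y ≠ 0) :
    ∑ x, (if Algebra.trace K F (x * y) = 0 then e x else 0) =
      (Fintype.card K - 1) * e (δ / y) := by
  calc
    _ = ∑ k : K, e (algebraMap K F k * (δ / y)) := by
      rw [← sum_filter]
      symm
      refine sum_nbij (fun k => algebraMap K F k * (δ / y)) ?_ ?_ ?_ fun _ _ => rfl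
      · intro k _
        rw [mem_filter, mul_assoc, div_mul_cancel₀ _ hy, ← Algebra.smul_def (A := F) k δ,
          map_smul, htr]
        simp
      · intro a _ b _ hab
        exact (algebraMap K F).injective (mul_right_cancel₀ (div_ne_zero hδ hy) hab)
      · intro x hx
        obtain ⟨k, hk⟩ := exists_algebraMap_mul_eq_of_trace_eq_zero hF hδ htr
          (mem_filter.1 hx).2
        refine ⟨k, mem_coe.2 (mem_univ k), ?_⟩
        simp only
        rw [← mul_div_assoc, hk, mul_div_cancel_right₀ _ hy]
    _ = ∑ k : K, (e (δ / y) - if k = 0 then e (δ / y) else 0) := by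
      refine sum_congr rfl fun k _ => ?_
      split_ifs with hk
      · simp [hk, h0]
      · rw [he k hk, sub_zero]
    _ = _ := by
      rw [sum_sub_distrib]
      simp [sub_mul]

theorem traceFourier_of_invariant {ψ : AddChar K ℂ} (hψ : ψ ≠ 1)
    (hF : Module.finrank K F = 2) {e : F → ℂ} (h0 : e 0 = 0)
    (he : ∀ k : K, k ≠ 0 → ∀ x, e (algebraMap K F k * x) = e x) {δ : F} (hδ : δ ≠ 0)
    (htr : Algebra.trace K F δ = 0) {y : F} (hy : y ≠ 0) :
    ((Fintype.card K : ℂ) - 1) * traceFourier ψ e y =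
      Fintype.card K * (Fintype.card K - 1) * e (δ / y) - ∑ x, e x := by
  have h1 : ∑ k : K, ∑ x, e x * ψ (k * Algebra.trace K F (x * y)) =
      Fintype.card K * ∑ x, (if Algebra.trace K F (x * y) = 0 then e x else 0) := by
    rw [sum_comm, mul_sum]
    refine sum_congr rfl fun x _ => ?_
    rw [← mul_sum, AddChar.sum_mulShift _ (AddChar.IsPrimitive.of_ne_one hψ)]
    split_ifs <;> simp [mul_comm]
  have h2 : ∑ k : K, ∑ x, e x * ψ (k * Algebra.trace K F (x * y)) =
      ∑ k : K, (traceFourier ψ e y + if k = 0 then ∑ x, e x - traceFourier ψ e y else 0) := by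
    refine sum_congr rfl fun k _ => ?_
    split_ifs with hk
    · simp [hk]
    · simp [traceFourier_eq_sum_algebraMap_mul ψ e hk y, he k hk]
  rw [sum_ite_trace_eq_zero hF h0 he hδ htr hy, h2, sum_add_distrib] at h1
  simp at h1
  linear_combination h1

theorem traceFourier_of_mulChar {ψ : AddChar K ℂ} {η : MulChar K ℂ} (hη : η ≠ 1)
    (hη2 : η.IsQuadratic) {o : F → ℂ}
    (ho : ∀ k : K, k ≠ 0 → ∀ x, o (algebraMap K F k * x) = η k * o x) (y : F) :
    ((Fintype.card K : ℂ) - 1) * traceFourier ψ o y =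
      gaussSum η ψ * ∑ x, o x * η (Algebra.trace K F (x * y)) := by
  have h1 (k : K) : ∑ x, o x * (η k * ψ (k * Algebra.trace K F (x * y))) =
      traceFourier ψ o y - if k = 0 then traceFourier ψ o y else 0 := by
    split_ifs with hk
    · simp [hk, MulChar.map_zero]
    · rw [traceFourier_eq_sum_algebraMap_mul ψ o hk y, sub_zero]
      refine sum_congr rfl fun x _ => ?_
      rw [ho k hk]
      ring
  have h2 (t : K) : ∑ k, η k * ψ (k * t) = gaussSum η ψ * η t := by
    rcases eq_or_ne t 0 with rfl | ht
    · simp [MulChar.sum_eq_zero_of_ne_one hη, MulChar.map_zero]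
    · have h3 := gaussSum_mulShift_eq η ψ (Units.mk0 t ht)
      rw [hη2.inv] at h3
      simpa [gaussSum, AddChar.mulShift_apply, mul_comm] using h3
  calc
    _ = ∑ k : K, ∑ x, o x * (η k * ψ (k * Algebra.trace K F (x * y))) := by
      simp [h1, sub_mul]
    _ = _ := by
      rw [sum_comm, mul_sum]
      refine sum_congr rfl fun x _ => ?_
      rw [← mul_sum, h2]
      ring

end TraceFourier

theorem sum_zmod_eight {M : Type*} [AddCommMonoid M] (f : ZMod 8 → M) :
    ∑ j, f j = f 0 + f 1 + f 2 + f 3 + f 4 + f 5 + f 6 + f 7 :=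
  Fin.sum_univ_eight f

/-- The function on `ZMod 8` with `f (j + 4) = f j` and the given values at `0, 1, 2, 3`. -/
def octicEven (a b c d : ℤ) : ZMod 8 → ℤ := ![a, b, c, d, a, b, c, d]

/-- The function on `ZMod 8` with `f (j + 4) = -f j` and the given values at `0, 1, 2, 3`. -/
def octicOdd (a b c d : ℤ) : ZMod 8 → ℤ := ![a, b, c, d, -a, -b, -c, -d]

theorem octicOdd_add_four (a b c d : ℤ) (j : ZMod 8) :
    octicOdd a b c d (j + 4) = -octicOdd a b c d j := by
  fin_cases j
  · rfl
  · rfl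
  · rfl
  · rfl
  · exact (neg_neg a).symm
  · exact (neg_neg b).symm
  · exact (neg_neg c).symm
  · exact (neg_neg d).symm

namespace IsQuadraticGenerator

variable {K F : Type*} [Field K] [Field F] [Fintype K] [Fintype F] [Algebra K F] {q : ℕ} {γ : F}

section BaseCharacter

variable [DecidableEq K]

/-- The quadratic character of `K`, read off from the discrete logarithm of `F`. -/
noncomputable def baseCharacter (h : IsQuadraticGenerator K q γ) : MulChar K ℂ where
  toFun k := if k = 0 then 0 else if octicClass γ (algebraMap K F k) = 0 then 1 else -1
  map_one' := by
    have := h.octicClass_pow 0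
    simp_all
  map_mul' a b := by
    by_cases ha : a = 0
    · simp [ha]
    by_cases hb : b = 0
    · simp [hb]
    have ha' : algebraMap K F a ≠ 0 := by simpa using ha
    have hb' : algebraMap K F b ≠ 0 := by simpa using hb
    have h0 : (4 : ZMod 8) ≠ 0 := by decide
    have h8 : (4 + 4 : ZMod 8) = 0 := rfl
    rcases h.octicClass_algebraMap ha with h1 | h1 <;>
      rcases h.octicClass_algebraMap hb with h2 | h2 <;>
      simp [ha, hb, h.octicClass_mul ha' hb', h1, h2, h0, h8]
  map_nonunit' a ha := if_pos (by simpa using ha)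

theorem baseCharacter_apply (h : IsQuadraticGenerator K q γ) (k : K) : h.baseCharacter k =
    if k = 0 then 0 else if octicClass γ (algebraMap K F k) = 0 then 1 else -1 :=
  rfl

theorem isQuadratic_baseCharacter (h : IsQuadraticGenerator K q γ) :
    h.baseCharacter.IsQuadratic := by
  intro k
  rw [h.baseCharacter_apply]
  split_ifs <;> simp

theorem baseCharacter_neg_one (h : IsQuadraticGenerator K q γ) : h.baseCharacter (-1) = -1 := by
  have h0 : (4 : ZMod 8) ≠ 0 := by decide
  simp [h.baseCharacter_apply, h.octicClass_neg_one, h0]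

theorem baseCharacter_ne_one (h : IsQuadraticGenerator K q γ) : h.baseCharacter ≠ 1 := by
  intro h1
  have h2 := h.baseCharacter_neg_one
  rw [h1, MulChar.one_apply (by simp)] at h2
  norm_num at h2

theorem gaussSum_baseCharacter_sq (h : IsQuadraticGenerator K q γ) {ψ : AddChar K ℂ}
    (hψ : ψ ≠ 1) : gaussSum h.baseCharacter ψ ^ 2 = -q := by
  rw [gaussSum_sq h.baseCharacter_ne_one h.isQuadratic_baseCharacter
    (AddChar.IsPrimitive.of_ne_one hψ), h.baseCharacter_neg_one, h.card_base, neg_one_mul]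

theorem apply_octicClass_algebraMap_mul (h : IsQuadraticGenerator K q γ) {o : ZMod 8 → ℂ}
    (ho : ∀ j, o (j + 4) = -o j) {k : K} (hk : k ≠ 0) {x : F} (hx : x ≠ 0) :
    o (octicClass γ (algebraMap K F k * x)) = h.baseCharacter k * o (octicClass γ x) := by
  have hk' : algebraMap K F k ≠ 0 := by simpa using hk
  have h0 : (4 : ZMod 8) ≠ 0 := by decide
  rw [h.octicClass_mul hk' hx, h.baseCharacter_apply, if_neg hk, add_comm]
  rcases h.octicClass_algebraMap hk with h1 | h1 <;> simp [h1, h0, ho]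

end BaseCharacter

theorem exists_trace_eq_zero (h : IsQuadraticGenerator K q γ) :
    ∃ δ : F, δ ≠ 0 ∧ Algebra.trace K F δ = 0 ∧
      (octicClass γ δ = 2 ∨ octicClass γ δ = 6) := by
  have h1 : 0 < Module.finrank K (LinearMap.ker (Algebra.trace K F)) := by
    rw [finrank_ker_trace h.finrank]; norm_num
  obtain ⟨⟨δ, htr⟩, hδ⟩ := Module.finrank_pos_iff_exists_ne_zero.1 h1
  have hδ' : δ ≠ 0 := by simpa [Subtype.ext_iff] using hδ
  refine ⟨δ, hδ', htr, ?_⟩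
  have h2 := FiniteField.algebraMap_trace_eq_sum_pow K F δ
  rw [LinearMap.mem_ker.1 htr, h.finrank, map_zero, sum_range_succ, sum_range_one, pow_zero,
    pow_one, pow_one, Nat.card_eq_fintype_card, h.card_base, eq_comm,
    add_eq_zero_iff_eq_neg'] at h2
  have h3 := h.octicClass_frobenius hδ'
  rw [h2, h.octicClass_neg hδ'] at h3
  revert h3
  generalize octicClass γ δ = l
  revert l
  decide

variable [DecidableEq K]

/-- The normalised sum of the quadratic character of the trace over an octic class. -/
noncomputable def traceCharSum (h : IsQuadraticGenerator K q γ) (j : ZMod 8) : ℂ :=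
  2 / (q - 1) * ∑ x : F, if octicClass γ x = j then h.baseCharacter (Algebra.trace K F x) else 0

theorem traceCharSum_add_four (h : IsQuadraticGenerator K q γ) (j : ZMod 8) :
    h.traceCharSum (j + 4) = -h.traceCharSum j := by
  rw [traceCharSum, traceCharSum, ← mul_neg, ← sum_neg_distrib]
  congr 1
  refine Fintype.sum_equiv (Equiv.neg F) _ _ fun x => ?_
  by_cases hx : x = 0
  · simp [hx, MulChar.map_zero]
  have h4 : (j + 4 + 4 : ZMod 8) = j := by rw [add_assoc]; exact add_zero j
  have hiff : octicClass γ (-x) = j ↔ octicClass γ x = j + 4 := by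
    rw [h.octicClass_neg hx]
    exact ⟨fun h1 => by rw [← h1, add_assoc]; exact (add_zero _).symm, fun h1 => by rw [h1, h4]⟩
  rw [Equiv.neg_apply, map_neg, ← neg_one_mul (Algebra.trace K F x), map_mul,
    h.baseCharacter_neg_one]
  simp only [hiff]
  split_ifs <;> simp

theorem traceCharSum_three_mul (h : IsQuadraticGenerator K q γ) (j : ZMod 8) :
    h.traceCharSum (3 * j) = h.traceCharSum j := by
  rw [traceCharSum, traceCharSum]
  congr 1
  symm
  refine Fintype.sum_equiv (FiniteField.frobeniusAlgEquivOfAlgebraic K F).toEquiv _ _ fun x => ?_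
  by_cases hx : x = 0
  · simp [hx, MulChar.map_zero]
  have hiff (a : ZMod 8) : 3 * a = 3 * j ↔ a = j := by
    revert a j; decide
  rw [AlgEquiv.toEquiv_eq_coe, EquivLike.coe_coe, Algebra.trace_eq_of_algEquiv,
    FiniteField.coe_frobeniusAlgEquivOfAlgebraic, h.card_base, h.octicClass_frobenius hx]
  simp only [hiff]

variable [DecidableEq F]

theorem traceFourier_octicClass (h : IsQuadraticGenerator K q γ) (ψ : AddChar K ℂ)
    {o : ZMod 8 → ℂ} (ho : ∀ j, o (j + 4) = -o j) {y : F} (hy : y ≠ 0) :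
    traceFourier ψ (fun x : F => if x = 0 then 0 else o (octicClass γ x)) y =
      gaussSum h.baseCharacter ψ * ((∑ j, o (j - octicClass γ y) * h.traceCharSum j) / 2) := by
  have h1 := traceFourier_of_mulChar (ψ := ψ) h.baseCharacter_ne_one h.isQuadratic_baseCharacter
    (o := fun x : F => if x = 0 then 0 else o (octicClass γ x)) (fun k hk x => by
      by_cases hx : x = 0
      · simp [hx]
      · simpa [hx, hk] using h.apply_octicClass_algebraMap_mul ho hk hx) y
  have h2 : ∑ x : F, (if x = 0 then 0 else o (octicClass γ x)) *
      h.baseCharacter (Algebra.trace K F (x * y)) = ∑ j, o (j - octicClass γ y) *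
        ∑ x : F, if octicClass γ x = j then h.baseCharacter (Algebra.trace K F x) else 0 := by
    simp only [mul_sum]
    rw [sum_comm]
    refine Fintype.sum_equiv (Equiv.mulRight₀ y hy) _ _ fun x => ?_
    change _ = ∑ j, o (j - octicClass γ y) *
      if octicClass γ (x * y) = j then h.baseCharacter (Algebra.trace K F (x * y)) else 0
    by_cases hx : x = 0
    · simp [hx, MulChar.map_zero]
    · simp [hx, h.octicClass_mul hx hy]
  have hq : (q : ℂ) - 1 ≠ 0 := by
    obtain ⟨t, rfl⟩ := h.exists_eq
    rw [sub_ne_zero]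
    exact_mod_cast (by omega : 8 * t + 3 ≠ 1)
  rw [h2, h.card_base] at h1
  refine mul_left_cancel₀ hq (h1.trans ?_)
  simp only [traceCharSum, mul_left_comm _ (2 / ((q : ℂ) - 1)), ← mul_sum]
  field_simp

omit [DecidableEq K] in
theorem sum_ite_octicClass_eq_zero (h : IsQuadraticGenerator K q γ) {o : ZMod 8 → ℂ}
    (ho : ∀ j, o (j + 4) = -o j) :
    ∑ x : F, (if x = 0 then 0 else o (octicClass γ x)) = 0 := by
  have h0 : ∑ j, o j = 0 := by
    have h1 : ∑ j, o (j + 4) = ∑ j, o j := Equiv.sum_comp (Equiv.addRight 4) o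
    simp only [ho, sum_neg_distrib] at h1
    exact self_eq_neg.1 h1.symm
  have h1 := h.sum_ite_octicClass o
  rw [h0, mul_zero] at h1
  simpa using h1

theorem sum_traceCharSum_sq (h : IsQuadraticGenerator K q γ) :
    ∑ j, h.traceCharSum j ^ 2 = 2 * q := by
  obtain ⟨ψ, hψ⟩ : ∃ ψ : AddChar K ℂ, ψ ≠ 1 := by
    obtain ⟨ψ, hψ⟩ := AddChar.exists_apply_ne_zero.2 (one_ne_zero (α := K))
    exact ⟨ψ, AddChar.ne_one_iff.2 ⟨1, hψ⟩⟩
  set o : ZMod 8 → ℂ := fun j => octicOdd 1 0 0 0 j with hdef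
  have ho (j) : o (j + 4) = -o j := by
    simp [hdef, octicOdd_add_four]
  have hsum (l : ZMod 8) : ∑ j, o (j - l) * h.traceCharSum j = 2 * h.traceCharSum l := by
    rw [← Equiv.sum_comp (Equiv.addRight l), sum_zmod_eight]
    simp only [Equiv.coe_addRight, add_sub_cancel_right]
    have h0 : o 0 = 1 := by norm_num [hdef, show octicOdd 1 0 0 0 0 = 1 from rfl]
    have h4 : o 4 = -1 := by norm_num [hdef, show octicOdd 1 0 0 0 4 = -1 from rfl]
    have h1 : o 1 = 0 ∧ o 2 = 0 ∧ o 3 = 0 ∧ o 5 = 0 ∧ o 6 = 0 ∧ o 7 = 0 := by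
      simp only [hdef, Int.cast_eq_zero]
      decide
    obtain ⟨h1, h2, h3, h5, h6, h7⟩ := h1
    rw [h0, h1, h2, h3, h4, h5, h6, h7, zero_add, add_comm 4 l, h.traceCharSum_add_four]
    ring
  have hw := sum_traceFourier_mul hψ
    (fun x : F => if x = 0 then 0 else o (octicClass γ x)) 0
  have hl : ∑ y : F, traceFourier ψ (fun x : F => if x = 0 then 0 else o (octicClass γ x)) y *
      traceFourier ψ (fun x : F => if x = 0 then 0 else o (octicClass γ x)) (-y) *
        ψ (Algebra.trace K F (y * 0)) =
      ∑ y : F, if y = 0 then 0 else q * h.traceCharSum (octicClass γ y) ^ 2 := by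
    refine sum_congr rfl fun y _ => ?_
    split_ifs with hy
    · simp [hy, traceFourier_zero_right, h.sum_ite_octicClass_eq_zero ho]
    · rw [h.traceFourier_octicClass ψ ho hy, h.traceFourier_octicClass ψ ho (neg_ne_zero.2 hy),
        hsum, hsum, h.octicClass_neg hy, h.traceCharSum_add_four, mul_zero, map_zero,
        AddChar.map_zero_eq_one]
      linear_combination (-h.traceCharSum (octicClass γ y) ^ 2) * h.gaussSum_baseCharacter_sq hψ
  have hr : ∑ x : F, (if x = 0 then 0 else o (octicClass γ x)) *
      (if x + 0 = 0 then 0 else o (octicClass γ (x + 0))) =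
      ∑ x : F, if x = 0 then 0 else o (octicClass γ x) ^ 2 := by
    refine sum_congr rfl fun x _ => ?_
    rw [add_zero]
    split_ifs <;> ring
  have h1 := h.sum_ite_octicClass fun j => q * h.traceCharSum j ^ 2
  have h2 := h.sum_ite_octicClass fun j => o j ^ 2
  have h3 : ∑ j, o j ^ 2 = 2 := by
    have : ∑ j, octicOdd 1 0 0 0 j ^ 2 = 2 := by decide
    simp only [hdef]
    exact_mod_cast this
  rw [hl, hr, h.card_eq] at hw
  rw [← mul_sum, hw] at h1
  rw [h3] at h2
  obtain ⟨t, rfl⟩ := h.exists_eq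
  have hq : ((8 * t + 3 : ℕ) : ℂ) ≠ 0 := Nat.cast_ne_zero.2 (by omega)
  have hq2 : ((8 * t + 3 : ℕ) : ℂ) ^ 2 - 1 ≠ 0 := by
    rw [sub_ne_zero]
    have := Nat.pow_le_pow_left (by omega : 3 ≤ 8 * t + 3) 2
    exact_mod_cast (by omega : (8 * t + 3) ^ 2 ≠ 1)
  refine mul_left_cancel₀ (mul_ne_zero hq hq2) ?_
  push_cast at *
  linear_combination (8 * t + 3 : ℂ) ^ 2 * h2 - h1

omit [DecidableEq F] in
theorem traceCharSum_values (h : IsQuadraticGenerator K q γ) :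
    h.traceCharSum 2 = 0 ∧ h.traceCharSum 3 = h.traceCharSum 1 ∧
      h.traceCharSum 4 = -h.traceCharSum 0 ∧ h.traceCharSum 5 = -h.traceCharSum 1 ∧
      h.traceCharSum 6 = 0 ∧ h.traceCharSum 7 = -h.traceCharSum 1 := by
  have h3 : h.traceCharSum 3 = h.traceCharSum 1 := h.traceCharSum_three_mul 1
  have h6 : h.traceCharSum 6 = h.traceCharSum 2 := h.traceCharSum_three_mul 2
  have h6' : h.traceCharSum 6 = -h.traceCharSum 2 := h.traceCharSum_add_four 2
  have h2 : h.traceCharSum 2 = 0 := self_eq_neg.1 (h6.symm.trans h6')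
  exact ⟨h2, h3, h.traceCharSum_add_four 0, h.traceCharSum_add_four 1, h6.trans h2,
    (h.traceCharSum_add_four 3).trans (congrArg _ h3)⟩

theorem traceCharSum_sq_add (h : IsQuadraticGenerator K q γ) :
    h.traceCharSum 0 ^ 2 + 2 * h.traceCharSum 1 ^ 2 = q := by
  have hs := h.sum_traceCharSum_sq
  obtain ⟨h2, h3, h4, h5, h6, h7⟩ := h.traceCharSum_values
  rw [sum_zmod_eight, h2, h3, h4, h5, h6, h7] at hs
  linear_combination hs / 2

omit [DecidableEq F] in
theorem sum_mul_traceCharSum (h : IsQuadraticGenerator K q γ) {o : ZMod 8 → ℂ}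
    (ho : ∀ j, o (j + 4) = -o j) (l : ZMod 8) :
    (∑ j, o (j - l) * h.traceCharSum j) / 2 =
      o (-l) * h.traceCharSum 0 + (o (1 - l) + o (3 - l)) * h.traceCharSum 1 := by
  obtain ⟨h2, h3, h4, h5, h6, h7⟩ := h.traceCharSum_values
  have h8 (a b : ZMod 8) (hab : b = a + 4) : o (b - l) = -o (a - l) := by
    rw [← ho, hab, add_sub_right_comm]
  rw [sum_zmod_eight, h2, h3, h4, h5, h6, h7, h8 0 4 rfl, h8 1 5 rfl, h8 3 7 rfl, zero_sub]
  ring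

omit [DecidableEq K] in
theorem traceFourier_blockSign (h : IsQuadraticGenerator K q γ) {ψ : AddChar K ℂ} (hψ : ψ ≠ 1)
    {c : ZMod 8 → ℂ} (hc : ∀ j, c (j + 4) = c j) {δ : F} (hδ : δ ≠ 0)
    (htr : Algebra.trace K F δ = 0) {y : F} (hy : y ≠ 0) :
    traceFourier ψ
        (fun x : F => if x = 0 then 0 else c (octicClass γ x) * blockSign (q + 1) γ x) y =
      q * (c (octicClass γ (δ / y)) * blockSign (q + 1) γ (δ / y)) - (c 0 + c 1 + c 2 + c 3) := by
  classical
  have h1 := traceFourier_of_invariant hψ h.finrank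
    (e := fun x : F => if x = 0 then 0 else c (octicClass γ x) * blockSign (q + 1) γ x) (by simp)
    (fun k hk x => by
      by_cases hx : x = 0
      · simp [hx]
      have hk' : algebraMap K F k ≠ 0 := by simpa using hk
      have hck : c (octicClass γ (algebraMap K F k * x)) = c (octicClass γ x) := by
        rw [h.octicClass_mul hk' hx, add_comm]
        rcases h.octicClass_algebraMap hk with h1 | h1 <;> simp [h1, hc]
      simp [hx, hk, h.blockSign_algebraMap_mul hk hx, hck]) hδ htr hy
  rw [h.sum_ite_blockSign c hc, if_neg (div_ne_zero hδ hy), h.card_base] at h1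
  have hq : (q : ℂ) - 1 ≠ 0 := by
    obtain ⟨t, rfl⟩ := h.exists_eq
    rw [sub_ne_zero]
    exact_mod_cast (by omega : 8 * t + 3 ≠ 1)
  refine mul_left_cancel₀ hq (h1.trans ?_)
  ring

end IsQuadraticGenerator

/-- The function with value `f₀` at `0` which is elsewhere the sum of a function of the octic class
twisted by `blockSign` and a function of the octic class. -/
noncomputable def octicFunction {F : Type*} [Field F] [DecidableEq F] (r : ℕ) (γ : F) (f₀ : ℤ)
    (c o : ZMod 8 → ℤ) (x : F) : ℤ :=
  if x = 0 then f₀ else c (octicClass γ x) * blockSign r γ x + o (octicClass γ x)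

theorem traceFourier_octicFunction {K F : Type*} [Field K] [Field F] [Fintype F] [Algebra K F]
    [DecidableEq F] (r : ℕ) (γ : F) (f₀ : ℤ) (c o : ZMod 8 → ℤ) (ψ : AddChar K ℂ) (y : F) :
    traceFourier ψ (fun x : F => (octicFunction r γ f₀ c o x : ℂ)) y = f₀ +
      (traceFourier ψ
        (fun x : F => if x = 0 then 0 else (c (octicClass γ x) : ℂ) * blockSign r γ x) y +
      traceFourier ψ (fun x : F => if x = 0 then 0 else (o (octicClass γ x) : ℂ)) y) := by
  rw [← traceFourier_add, ← traceFourier_ite_zero ψ (f₀ : ℂ) y, ← traceFourier_add]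
  congr 1
  ext x
  rw [octicFunction]
  split_ifs <;> simp

namespace IsQuadraticGenerator

variable {K F : Type*} [Field K] [Field F] [Fintype K] [Fintype F] [Algebra K F] {q : ℕ} {γ : F}
  [DecidableEq F] {f₀ : ℤ} {c o : ZMod 8 → ℤ}

theorem sum_octicFunction (h : IsQuadraticGenerator K q γ) (hc : ∀ j, c (j + 4) = c j)
    (ho : ∀ j, o (j + 4) = -o j) :
    ∑ x, octicFunction (q + 1) γ f₀ c o x = f₀ + (q - 1) * (c 0 + c 1 + c 2 + c 3) := by
  have h1 := traceFourier_octicFunction (q + 1) γ f₀ c o (1 : AddChar K ℂ) 0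
  have h2 := h.sum_ite_blockSign (fun j => (c j : ℂ)) fun j => by rw [hc]
  have h3 := h.sum_ite_octicClass_eq_zero (o := fun j => (o j : ℂ)) fun j => by rw [ho]; simp
  rw [traceFourier_zero_right, traceFourier_zero_right, traceFourier_zero_right, h2, h3,
    add_zero] at h1
  exact_mod_cast h1

theorem traceFourier_mul_neg_octicFunction [DecidableEq K] (h : IsQuadraticGenerator K q γ)
    {ψ : AddChar K ℂ} (hψ : ψ ≠ 1) (hc : ∀ j, c (j + 4) = c j) (ho : ∀ j, o (j + 4) = -o j)
    {δ : F} (hδ : δ ≠ 0) (htr : Algebra.trace K F δ = 0)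
    (hcl : octicClass γ δ = 2 ∨ octicClass γ δ = 6) {y : F} (hy : y ≠ 0) :
    traceFourier ψ (fun x : F => (octicFunction (q + 1) γ f₀ c o x : ℂ)) y *
        traceFourier ψ (fun x : F => (octicFunction (q + 1) γ f₀ c o x : ℂ)) (-y) =
      (f₀ - (c 0 + c 1 + c 2 + c 3) +
        q * (c (2 - octicClass γ y) * blockSign (q + 1) γ (δ / y))) ^ 2 +
      q * (o (-octicClass γ y) * h.traceCharSum 0 +
        (o (1 - octicClass γ y) + o (3 - octicClass γ y)) * h.traceCharSum 1) ^ 2 := by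
  have hc' (j) : (c (j + 4) : ℂ) = c j := by rw [hc]
  have ho' (j) : (o (j + 4) : ℂ) = -o j := by rw [ho]; simp
  have hcd : c (octicClass γ (δ / y)) = c (2 - octicClass γ y) := by
    rw [h.octicClass_div hδ hy]
    rcases hcl with h1 | h1
    · rw [h1]
    · rw [h1, ← hc (2 - _), sub_add_eq_add_sub]
      rfl
  have hcn : c (octicClass γ (-(δ / y))) = c (octicClass γ (δ / y)) := by
    rw [h.octicClass_neg (div_ne_zero hδ hy), hc]
  have hon (i : ZMod 8) : (o (i - (octicClass γ y + 4)) : ℂ) = -o (i - octicClass γ y) := by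
    have h1 := ho' (i - octicClass γ y - 4)
    rw [sub_add_cancel] at h1
    rw [← sub_sub, h1, neg_neg]
  have hon0 : (o (-(octicClass γ y + 4)) : ℂ) = -o (-octicClass γ y) := by
    simpa using hon 0
  rw [traceFourier_octicFunction, traceFourier_octicFunction,
    h.traceFourier_octicClass (o := fun j => (o j : ℂ)) ψ ho' hy,
    h.traceFourier_octicClass (o := fun j => (o j : ℂ)) ψ ho' (neg_ne_zero.2 hy),
    h.traceFourier_blockSign (c := fun j => (c j : ℂ)) hψ hc' hδ htr hy,
    h.traceFourier_blockSign (c := fun j => (c j : ℂ)) hψ hc' hδ htr (neg_ne_zero.2 hy),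
    h.sum_mul_traceCharSum (o := fun j => (o j : ℂ)) ho',
    h.sum_mul_traceCharSum (o := fun j => (o j : ℂ)) ho', div_neg,
    h.blockSign_neg (div_ne_zero hδ hy), hcn, hcd, h.octicClass_neg hy, hon0, hon, hon]
  linear_combination (-(o (-octicClass γ y) * h.traceCharSum 0 +
        (o (1 - octicClass γ y) + o (3 - octicClass γ y)) * h.traceCharSum 1) ^ 2) *
    h.gaussSum_baseCharacter_sq hψ

/-- A family of four functions built from octic classes, subject to integral conditions on the
coefficients, has constant autocorrelation off the origin. -/
theorem sum_autocorrelation_octicFunction (h : IsQuadraticGenerator K q γ) {f₀ : Fin 4 → ℤ}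
    {c o : Fin 4 → ZMod 8 → ℤ} (hc : ∀ k j, c k (j + 4) = c k j) (ho : ∀ k j, o k (j + 4) = -o k j)
    {b : ℤ} (hf : ∑ k, (f₀ k - (c k 0 + c k 1 + c k 2 + c k 3)) ^ 2 = 4)
    (hfc : ∀ l, ∑ k, (f₀ k - (c k 0 + c k 1 + c k 2 + c k 3)) * c k (2 - l) = 0)
    (hco : ∀ l, ∑ k, (c k (2 - l) ^ 2 + o k (-l) ^ 2) = 8)
    (hoo : ∀ l, ∑ k, o k (-l) * (o k (1 - l) + o k (3 - l)) = 0)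
    (hoo' : ∀ l, ∑ k, (o k (1 - l) + o k (3 - l)) ^ 2 = ∑ k, 2 * o k (-l) ^ 2)
    (hb : ∑ k, (f₀ k + (q - 1) * (c k 0 + c k 1 + c k 2 + c k 3)) ^ 2 =
      8 * q ^ 2 + 4 + q ^ 2 * b) (z : F) :
    ∑ k, ∑ x, octicFunction (q + 1) γ (f₀ k) (c k) (o k) x *
      octicFunction (q + 1) γ (f₀ k) (c k) (o k) (x + z) =
        (if z = 0 then 8 * (q : ℤ) ^ 2 + 4 else 0) + b := by
  classical
  obtain ⟨ψ, hψ⟩ : ∃ ψ : AddChar K ℂ, ψ ≠ 1 := by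
    obtain ⟨ψ, hψ⟩ := AddChar.exists_apply_ne_zero.2 (one_ne_zero (α := K))
    exact ⟨ψ, AddChar.ne_one_iff.2 ⟨1, hψ⟩⟩
  obtain ⟨δ, hδ, htr, hcl⟩ := h.exists_trace_eq_zero
  have hspec (y : F) : ∑ k,
      traceFourier ψ (fun x : F => (octicFunction (q + 1) γ (f₀ k) (c k) (o k) x : ℂ)) y *
      traceFourier ψ (fun x : F => (octicFunction (q + 1) γ (f₀ k) (c k) (o k) x : ℂ)) (-y) =
      (8 * q ^ 2 + 4 : ℂ) + if y = 0 then (q ^ 2 * b : ℂ) else 0 := by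
    split_ifs with hy
    · have hs (k) := h.sum_octicFunction (f₀ := f₀ k) (hc k) (ho k)
      simp only [hy, neg_zero, traceFourier_zero_right, ← Int.cast_sum, hs, ← sq]
      exact_mod_cast hb
    · have hsign : ((blockSign (q + 1) γ (δ / y) : ℤ) : ℂ) ^ 2 = 1 := by
        rw [blockSign, ← Int.cast_pow, ← pow_mul, mul_comm, pow_mul]
        simp
      have hs := h.traceCharSum_sq_add
      simp only [h.traceFourier_mul_neg_octicFunction hψ (hc _) (ho _) hδ htr hcl hy]
      generalize octicClass γ y = l
      replace hf := congrArg (Int.cast (R := ℂ)) hf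
      replace hfc := congrArg (Int.cast (R := ℂ)) (hfc l)
      replace hco := congrArg (Int.cast (R := ℂ)) (hco l)
      replace hoo := congrArg (Int.cast (R := ℂ)) (hoo l)
      replace hoo' := congrArg (Int.cast (R := ℂ)) (hoo' l)
      push_cast [Fin.sum_univ_four] at hf hfc hco hoo hoo' ⊢
      have hso : (∑ k, (o k (-l) : ℂ) ^ 2) *
          (h.traceCharSum 0 ^ 2 + 2 * h.traceCharSum 1 ^ 2) = (∑ k, (o k (-l) : ℂ) ^ 2) * q := by
        rw [hs]
      simp only [Fin.sum_univ_four] at hso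
      linear_combination hf + 2 * q * (blockSign (q + 1) γ (δ / y) : ℂ) * hfc +
        (q : ℂ) ^ 2 * ((c 0 (2 - l) : ℂ) ^ 2 + (c 1 (2 - l) : ℂ) ^ 2 + (c 2 (2 - l) : ℂ) ^ 2 +
          (c 3 (2 - l) : ℂ) ^ 2) * hsign + (q : ℂ) ^ 2 * hco +
        2 * q * h.traceCharSum 0 * h.traceCharSum 1 * hoo + q * h.traceCharSum 1 ^ 2 * hoo' +
        q * hso
  have hfin := sum_autocorrelation_of_traceFourier hψ
    (fun k => octicFunction (q + 1) γ (f₀ k) (c k) (o k)) _ _ hspec z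
  have hq : (q : ℂ) ^ 2 ≠ 0 := by
    obtain ⟨t, rfl⟩ := h.exists_eq
    exact pow_ne_zero _ (Nat.cast_ne_zero.2 (by omega))
  rw [h.card_eq, Nat.cast_pow] at hfin
  have hgoal := mul_left_cancel₀ hq (hfin.trans
    (c := (q : ℂ) ^ 2 * (((if z = 0 then 8 * (q : ℤ) ^ 2 + 4 else 0) + b : ℤ) : ℂ))
    (by split_ifs <;> push_cast <;> ring))
  exact_mod_cast hgoal

end IsQuadraticGenerator

section Hadamard

theorem octicFunction_add {F : Type*} [Field F] [DecidableEq F] (r : ℕ) (γ : F) (f₀ f₁ : ℤ)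
    (c c' o o' : ZMod 8 → ℤ) (x : F) :
    octicFunction r γ f₀ c o x + octicFunction r γ f₁ c' o' x =
      octicFunction r γ (f₀ + f₁) (c + c') (o + o') x := by
  simp only [octicFunction, Pi.add_apply]
  split_ifs <;> ring

theorem octicFunction_sub {F : Type*} [Field F] [DecidableEq F] (r : ℕ) (γ : F) (f₀ f₁ : ℤ)
    (c c' o o' : ZMod 8 → ℤ) (x : F) :
    octicFunction r γ f₀ c o x - octicFunction r γ f₁ c' o' x =
      octicFunction r γ (f₀ - f₁) (c - c') (o - o') x := by
  simp only [octicFunction, Pi.sub_apply]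
  split_ifs <;> ring

theorem octicFunction_eq_one_or {F : Type*} [Field F] [DecidableEq F] (r : ℕ) (γ : F) {f₀ : ℤ}
    {c o : ZMod 8 → ℤ} (hf : f₀ = 1 ∨ f₀ = -1)
    (hco : ∀ j, (c j = 1 ∨ c j = -1) ∧ o j = 0 ∨ c j = 0 ∧ (o j = 1 ∨ o j = -1)) (x : F) :
    octicFunction r γ f₀ c o x = 1 ∨ octicFunction r γ f₀ c o x = -1 := by
  rw [octicFunction]
  split_ifs
  · exact hf
  · have hs : blockSign r γ x = 1 ∨ blockSign r γ x = -1 := neg_one_pow_eq_or ℤ _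
    rcases hco (octicClass γ x) with ⟨h1 | h1, h2⟩ | ⟨h1, h2 | h2⟩ <;> rcases hs with h3 | h3 <;>
      simp [h1, h2, h3]

theorem IsQuadraticGenerator.exists_hadamard {K F : Type*} [Field K] [Field F] [Fintype K]
    [Fintype F] [Algebra K F] {q : ℕ} {γ : F} (h : IsQuadraticGenerator K q γ) (n : ℕ)
    (hn : n = 4 * (2 * q ^ 2 + 1)) :
    ∃ H : Matrix (Fin n) (Fin n) ℤ, (∀ i j, H i j = 1 ∨ H i j = -1) ∧
      H * H.transpose = (n : ℤ) • 1 := by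
  classical
  let fa : Fin 4 → ℤ := ![1, 1, 1, 1]
  let fb : Fin 4 → ℤ := ![1, -1, -1, -1]
  let ca : Fin 4 → ZMod 8 → ℤ := ![octicEven 1 1 (-1) (-1), octicEven 0 1 0 (-1),
    octicEven 1 0 (-1) 1, octicEven 1 0 1 (-1)]
  let oa : Fin 4 → ZMod 8 → ℤ := ![octicOdd 0 0 0 0, octicOdd 1 0 1 0, octicOdd 0 1 0 0,
    octicOdd 0 1 0 0]
  let cb : Fin 4 → ZMod 8 → ℤ := ![octicEven (-1) (-1) 1 1, octicEven 0 1 0 (-1),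
    octicEven 1 (-1) (-1) 0, octicEven (-1) (-1) 1 0]
  let ob : Fin 4 → ZMod 8 → ℤ := ![octicOdd 0 0 0 0, octicOdd (-1) 0 1 0, octicOdd 0 0 0 (-1),
    octicOdd 0 0 0 (-1)]
  have hcard : (Fintype.card F : ℤ) = (q : ℤ) ^ 2 := by rw [h.card_eq, Nat.cast_pow]
  have hcadd : ∀ k j, (ca k + cb k) (j + 4) = (ca k + cb k) j := by decide
  have hoadd : ∀ k j, (oa k + ob k) (j + 4) = -(oa k + ob k) j := by decide
  have hcsub : ∀ k j, (ca k - cb k) (j + 4) = (ca k - cb k) j := by decide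
  have hosub : ∀ k j, (oa k - ob k) (j + 4) = -(oa k - ob k) j := by decide
  have hc0 : ∀ k, (ca k + cb k) 0 + (ca k + cb k) 1 + (ca k + cb k) 2 + (ca k + cb k) 3 = 0 := by
    decide
  refine exists_hadamard_of_pairs (G := F)
    (fun k => octicFunction (q + 1) γ (fa k) (ca k) (oa k))
    (fun k => octicFunction (q + 1) γ (fb k) (cb k) (ob k)) n (by rw [hn, h.card_eq])
    (fun k => octicFunction_eq_one_or _ _ ?_ ?_) (fun k => octicFunction_eq_one_or _ _ ?_ ?_)
    ?_ (fun k hk => ?_) (fun z => ?_) (fun z => ?_)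
  · revert k; decide
  · revert k; decide
  · revert k; decide
  · revert k; decide
  · simp only [octicFunction_add]
    rw [h.sum_octicFunction (hcadd 0) (hoadd 0), hc0, mul_zero, add_zero]
    decide
  · simp only [octicFunction_add]
    rw [h.sum_octicFunction (hcadd k) (hoadd k), hc0, mul_zero, add_zero]
    revert k; decide
  · simp only [octicFunction_add]
    rw [h.sum_autocorrelation_octicFunction (f₀ := fun k => fa k + fb k)
      (c := fun k => ca k + cb k) (o := fun k => oa k + ob k) hcadd hoadd (b := -8) (by decide)
      (by decide) (by decide) (by decide) (by decide) ?_, hcard]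
    · split_ifs <;> ring
    · simp only [hc0, mul_zero, add_zero]
      rw [show ∑ k, (fa k + fb k) ^ 2 = 4 by decide]
      ring
  · simp only [octicFunction_sub]
    rw [h.sum_autocorrelation_octicFunction (f₀ := fun k => fa k - fb k)
      (c := fun k => ca k - cb k) (o := fun k => oa k - ob k) hcsub hosub (b := 0) (by decide)
      (by decide) (by decide) (by decide) (by decide) ?_, hcard]
    · split_ifs <;> ring
    · have hcs : ∀ k, (ca k - cb k) 0 + (ca k - cb k) 1 + (ca k - cb k) 2 + (ca k - cb k) 3 =
          ![0, 0, 2, 2] k := by decide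
      have hfs : ∀ k, fa k - fb k = ![0, 2, 2, 2] k := by decide
      simp only [hcs, hfs]
      simp [Fin.sum_univ_four]
      ring

theorem exists_isQuadraticGenerator {q : ℕ} (hq : IsPrimePow q) (hq8 : q % 8 = 3) :
    ∃ (K F : Type) (_ : Field K) (_ : Field F) (_ : Fintype K) (_ : Fintype F) (_ : Algebra K F)
      (γ : F), IsQuadraticGenerator K q γ := by
  obtain ⟨p, f, hp, hf, rfl⟩ := (isPrimePow_nat_iff q).1 hq
  have : Fact p.Prime := ⟨hp⟩
  let F := FiniteField.Extension (GaloisField p f) p 2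
  let := Fintype.ofFinite (GaloisField p f)
  let : Fintype F := Fintype.ofFinite F
  obtain ⟨γ, hγ⟩ := IsCyclic.exists_generator (α := Fˣ)
  refine ⟨GaloisField p f, F, inferInstance, inferInstance, inferInstance, inferInstance,
    inferInstance, γ, ?_, FiniteField.finrank_extension _ _ _, hq8, ?_⟩
  · rw [← Nat.card_eq_fintype_card, GaloisField.card p f hf.ne']
  · classical
    rw [orderOf_units, orderOf_eq_card_of_forall_mem_zpowers hγ, Nat.card_eq_fintype_card,
      Fintype.card_units]

end Hadamard

theorem stmt_1 (q : ℕ) (hq : IsPrimePow q) (c : ℤ)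
    (hc : (q : ℤ) = 12 * c ^ 2 + 4 * c + 3) :
    ∃ H : Matrix (Fin (4 * (2 * q ^ 2 + 1))) (Fin (4 * (2 * q ^ 2 + 1))) ℤ,
      (∀ i j, H i j = 1 ∨ H i j = -1) ∧
      H * H.transpose = (4 * (2 * q ^ 2 + 1) : ℤ) • 1 := by
  have hq8 : q % 8 = 3 := by
    obtain ⟨m, hm⟩ : Even (c * (3 * c + 1)) := by
      rcases Int.even_or_odd c with h | h
      · exact h.mul_right _
      · exact ((Odd.mul (by decide) h).add_odd odd_one).mul_left _
    have h1 : (q : ℤ) = 8 * m + 3 := by linear_combination hc + 4 * hm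
    omega
  obtain ⟨K, F, _, _, _, _, _, γ, h⟩ := exists_isQuadraticGenerator hq hq8
  simpa using h.exists_hadamard _ rfl
end
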